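/- Let ∑_{i=1}^k αᵢ sᵢ ≥ 1 with α ∈ ℝ^k, α ≥ 0, be a facet-defining inequality for conv(P(R,f)). Then the split rank of ∑_{i=1}^k αᵢ sᵢ ≥ 1 with respect to P(R,f)⁰ is finite if and only if its induced lattice-free set L_α is not a triangle of type T¹. -/

import Mathlib

open Set Pointwise

abbrev Pt : Type := Fin 2 → ℝ

def IsIntPt (x : Pt) : Prop := ∀ j, ∃ z : ℤ, x j = (z : ℝ)

def IsRatPt (x : Pt) : Prop := ∀ j, ∃ q : ℚ, x j = (q : ℝ)

/-- The mixed-integer set `P(R,f)`. -/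
def mixedP (k : ℕ) (r : Fin k → Pt) (f : Pt) : Set (Pt × (Fin k → ℝ)) :=
  {p | IsIntPt p.1 ∧ (∀ i, 0 ≤ p.2 i) ∧ p.1 = f + ∑ i, p.2 i • r i}

/-- The linear relaxation `P(R,f)⁰`. -/
def relaxP (k : ℕ) (r : Fin k → Pt) (f : Pt) : Set (Pt × (Fin k → ℝ)) :=
  {p | (∀ i, 0 ≤ p.2 i) ∧ p.1 = f + ∑ i, p.2 i • r i}

/-- The convex cone generated by a set (all nonnegative combinations). -/
def coneGen (S : Set Pt) : Set Pt :=
  {x | ∃ (n : ℕ) (c : Fin n → ℝ) (v : Fin n → Pt),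
    (∀ j, 0 ≤ c j) ∧ (∀ j, v j ∈ S) ∧ x = ∑ j, c j • v j}

/-- The induced lattice-free set `L_α`. -/
def inducedSet (k : ℕ) (r : Fin k → Pt) (f : Pt) (α : Fin k → ℝ) : Set Pt :=
  convexHull ℝ ({f} ∪ {x | ∃ i, 0 < α i ∧ x = f + (α i)⁻¹ • r i}) +
    coneGen {x | ∃ i, α i = 0 ∧ x = r i}

def LatticeFree (S : Set Pt) : Prop := ∀ x ∈ interior S, ¬ IsIntPt x

/-- Validity of `∑ αᵢ sᵢ ≥ γ` for `conv(P(R,f))`. -/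
def ValidIneq (k : ℕ) (r : Fin k → Pt) (f : Pt) (α : Fin k → ℝ) (γ : ℝ) : Prop :=
  ∀ p ∈ mixedP k r f, γ ≤ ∑ i, α i * p.2 i

noncomputable def affDim {V : Type*} [AddCommGroup V] [Module ℝ V] (S : Set V) : ℕ :=
  Module.finrank ℝ (affineSpan ℝ S).direction

/-- Facet-defining inequality: valid and its face of the closed convex hull has
affine dimension exactly one less. -/
def IsFacet (k : ℕ) (r : Fin k → Pt) (f : Pt) (α : Fin k → ℝ) (γ : ℝ) : Prop :=
  ValidIneq k r f α γ ∧
  affDim {p ∈ closure (convexHull ℝ (mixedP k r f)) | ∑ i, α i * p.2 i = γ} + 1 =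
    affDim (convexHull ℝ (mixedP k r f))

def splitClosure (k : ℕ) (C : Set (Pt × (Fin k → ℝ))) : Set (Pt × (Fin k → ℝ)) :=
  ⋂ (π : Fin 2 → ℤ) (π₀ : ℤ),
    convexHull ℝ ((C ∩ {p | ∑ j, (π j : ℝ) * p.1 j ≤ (π₀ : ℝ)}) ∪
      (C ∩ {p | (π₀ : ℝ) + 1 ≤ ∑ j, (π j : ℝ) * p.1 j}))

def closures (k : ℕ) (r : Fin k → Pt) (f : Pt) : ℕ → Set (Pt × (Fin k → ℝ))
  | 0 => relaxP k r f
  | n + 1 => splitClosure k (closures k r f n)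

/-- The split rank of `∑ αᵢ sᵢ ≥ γ` w.r.t. `P(R,f)⁰`: least `j` such that the
inequality is valid on the `j`-th split closure, `⊤` if none exists. -/
noncomputable def splitRank (k : ℕ) (r : Fin k → Pt) (f : Pt) (α : Fin k → ℝ) (γ : ℝ) : ℕ∞ :=
  sInf {j : ℕ∞ | ∃ n : ℕ, j = (n : ℕ∞) ∧ ∀ p ∈ closures k r f n, γ ≤ ∑ i, α i * p.2 i}

def IsSplitSet (S : Set Pt) : Prop :=
  ∃ (π : Fin 2 → ℤ) (π₀ : ℤ), π ≠ 0 ∧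
    S = {x : Pt | (π₀ : ℝ) ≤ ∑ j, (π j : ℝ) * x j ∧ ∑ j, (π j : ℝ) * x j ≤ (π₀ : ℝ) + 1}

/-- Triangle of type `T¹`. -/
def IsT1 (S : Set Pt) : Prop :=
  ∃ v : Fin 3 → Pt, AffineIndependent ℝ v ∧ (∀ i, IsIntPt (v i)) ∧
    S = convexHull ℝ (Set.range v) ∧
    ∀ i j, i ≠ j → ∃! z, z ∈ openSegment ℝ (v i) (v j) ∧ IsIntPt z

/-- Triangle of type `T^{2A}`. -/
def IsT2A (S : Set Pt) : Prop :=
  ∃ v0 v1 v2 : Pt, AffineIndependent ℝ ![v0, v1, v2] ∧ ¬ IsIntPt v0 ∧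
    S = convexHull ℝ {v0, v1, v2} ∧
    (∃ z1 z2 : Pt, z1 ≠ z2 ∧ IsIntPt z1 ∧ IsIntPt z2 ∧
      z1 ∈ segment ℝ v1 v2 ∧ z2 ∈ segment ℝ v1 v2) ∧
    (∃! z, z ∈ openSegment ℝ v0 v1 ∧ IsIntPt z) ∧
    (∃! z, z ∈ openSegment ℝ v0 v2 ∧ IsIntPt z)

/-- Triangle of type `T^{2B}`. -/
def IsT2B (S : Set Pt) : Prop :=
  ∃ v0 v1 v2 : Pt, AffineIndependent ℝ ![v0, v1, v2] ∧ ¬ IsIntPt v0 ∧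
    S = convexHull ℝ {v0, v1, v2} ∧
    (∃ z1 z2 : Pt, z1 ≠ z2 ∧ IsIntPt z1 ∧ IsIntPt z2 ∧
      z1 ∈ segment ℝ v1 v2 ∧ z2 ∈ segment ℝ v1 v2) ∧
    (∃! z, z ∈ openSegment ℝ v0 v1 ∧ IsIntPt z) ∧
    (∀ z ∈ openSegment ℝ v0 v2, ¬ IsIntPt z)

/-- Triangle of type `T³`. -/
def IsT3 (S : Set Pt) : Prop :=
  ∃ v0 v1 v2 : Pt, AffineIndependent ℝ ![v0, v1, v2] ∧
    ¬ IsIntPt v0 ∧ ¬ IsIntPt v1 ∧ ¬ IsIntPt v2 ∧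
    S = convexHull ℝ {v0, v1, v2} ∧
    (∃! z, z ∈ openSegment ℝ v0 v1 ∧ IsIntPt z) ∧
    (∃! z, z ∈ openSegment ℝ v1 v2 ∧ IsIntPt z) ∧
    (∃! z, z ∈ openSegment ℝ v0 v2 ∧ IsIntPt z) ∧
    (∀ z, IsIntPt z → z ∈ frontier S →
      z ∈ openSegment ℝ v0 v1 ∨ z ∈ openSegment ℝ v1 v2 ∨ z ∈ openSegment ℝ v0 v2)

/-- A quadrilateral with vertices `v 0, v 1, v 2, v 3` in cyclic order; each `vᵢ`
is an extreme point of the hull and each side lies on the boundary. -/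
def IsQuadWith (S : Set Pt) (v : Fin 4 → Pt) : Prop :=
  S = convexHull ℝ (Set.range v) ∧
  (∀ i, v i ∈ Set.extremePoints ℝ S) ∧
  (∀ i : Fin 4, segment ℝ (v i) (v (i + 1)) ⊆ frontier S)

/-- Quadrilateral of type `Q¹`. -/
def IsQ1 (S : Set Pt) : Prop :=
  ∃ v : Fin 4 → Pt, IsQuadWith S v ∧
    (∃ z1 z2 : Pt, z1 ≠ z2 ∧ IsIntPt z1 ∧ IsIntPt z2 ∧
      z1 ∈ segment ℝ (v 0) (v 1) ∧ z2 ∈ segment ℝ (v 0) (v 1)) ∧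
    (∃ j : Fin 4, j ≠ 0 ∧
      (∀ i : Fin 4, i ≠ 0 → i ≠ j → ∃ z, IsIntPt z ∧ z ∈ segment ℝ (v i) (v (i + 1))) ∧
      (∀ z ∈ openSegment ℝ (v j) (v (j + 1)), ¬ IsIntPt z)) ∧
    (∃ T : Set Pt, (IsT1 T ∨ IsT2A T) ∧ S ⊆ T)

/-- Quadrilateral of type `Q²`. -/
def IsQ2 (S : Set Pt) : Prop :=
  ∃ v : Fin 4 → Pt, IsQuadWith S v ∧ (∀ i, ¬ IsIntPt (v i)) ∧
    ∀ i : Fin 4, ∃! z, z ∈ openSegment ℝ (v i) (v (i + 1)) ∧ IsIntPt z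

section Basics

variable {k : ℕ} {r : Fin k → Pt} {f : Pt} {α : Fin k → ℝ}

theorem splitClosure_subset_of_convex {C H : Set (Pt × (Fin k → ℝ))} (hH : Convex ℝ H)
    (a b c : ℤ)
    (h₁ : ∀ p ∈ C, (a : ℝ) * p.1 0 + b * p.1 1 ≤ c → p ∈ H)
    (h₂ : ∀ p ∈ C, (c : ℝ) + 1 ≤ a * p.1 0 + b * p.1 1 → p ∈ H) :
    splitClosure k C ⊆ H := by
  intro p hp
  have := mem_iInter.1 (mem_iInter.1 hp ![a, b]) c
  refine convexHull_min ?_ hH this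
  rintro q (⟨hq, hq'⟩ | ⟨hq, hq'⟩)
  · exact h₁ q hq (by simpa [Fin.sum_univ_two] using hq')
  · exact h₂ q hq (by simpa [Fin.sum_univ_two] using hq')

theorem convex_splitClosure (C : Set (Pt × (Fin k → ℝ))) : Convex ℝ (splitClosure k C) :=
  convex_iInter fun _ => convex_iInter fun _ => convex_convexHull ℝ _

theorem convex_relaxP : Convex ℝ (relaxP k r f) := by
  rintro p ⟨hp, hp'⟩ q ⟨hq, hq'⟩ s t hs ht hst
  refine ⟨fun i => ?_, ?_⟩
  · have := mul_nonneg hs (hp i)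
    have := mul_nonneg ht (hq i)
    simp only [Prod.snd_add, Prod.smul_snd, Pi.add_apply, Pi.smul_apply, smul_eq_mul]
    linarith
  · simp only [Prod.snd_add, Prod.smul_snd, Prod.fst_add, Prod.smul_fst, Pi.add_apply,
      Pi.smul_apply, hp', hq', add_smul, Finset.sum_add_distrib, smul_add, Finset.smul_sum,
      smul_smul, smul_eq_mul]
    conv_rhs => rw [← one_smul ℝ f, ← hst, add_smul]
    abel

theorem convex_closures (n : ℕ) : Convex ℝ (closures k r f n) := by
  cases n with
  | zero => exact convex_relaxP
  | succ n => exact convex_splitClosure _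

theorem closures_succ_subset (n : ℕ) : closures k r f (n + 1) ⊆ closures k r f n :=
  splitClosure_subset_of_convex (convex_closures n) 0 0 0 (fun _ hp _ => hp) (fun _ hp _ => hp)

theorem closures_antitone : Antitone (closures k r f) :=
  antitone_nat_of_succ_le closures_succ_subset

theorem closures_subset_relaxP (n : ℕ) : closures k r f n ⊆ relaxP k r f :=
  closures_antitone (Nat.zero_le n)

theorem mem_splitClosure {C : Set (Pt × (Fin k → ℝ))} {p : Pt × (Fin k → ℝ)}
    (h : ∀ a b c : ℤ, p ∈ convexHull ℝ
      ((C ∩ {p | (a : ℝ) * p.1 0 + b * p.1 1 ≤ c}) ∪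
        (C ∩ {p | (c : ℝ) + 1 ≤ a * p.1 0 + b * p.1 1}))) : p ∈ splitClosure k C := by
  refine mem_iInter.2 fun π => mem_iInter.2 fun π₀ => ?_
  simpa [Fin.sum_univ_two] using h (π 0) (π 1) π₀

theorem mixedP_subset_closures (n : ℕ) : mixedP k r f ⊆ closures k r f n := by
  induction n with
  | zero => exact fun p hp => hp.2
  | succ n ih =>
    intro p hp
    refine mem_splitClosure fun a b c => subset_convexHull ℝ _ ?_
    obtain ⟨x, hx⟩ := hp.1 0
    obtain ⟨y, hy⟩ := hp.1 1
    rcases le_or_gt (a * x + b * y) c with h | h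
    · refine Or.inl ⟨ih hp, ?_⟩
      simp only [mem_ofPred_eq, hx, hy]
      exact_mod_cast h
    · refine Or.inr ⟨ih hp, ?_⟩
      simp only [mem_ofPred_eq, hx, hy]
      exact_mod_cast h

theorem splitRank_ne_top_iff {γ : ℝ} : splitRank k r f α γ ≠ ⊤ ↔
    ∃ n, ∀ p ∈ closures k r f n, γ ≤ ∑ i, α i * p.2 i := by
  constructor
  · intro h
    by_contra hn
    push Not at hn
    apply h
    have hempty : {j : ℕ∞ | ∃ n : ℕ, j = (n : ℕ∞) ∧
        ∀ p ∈ closures k r f n, γ ≤ ∑ i, α i * p.2 i} = ∅ := by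
      refine eq_empty_iff_forall_notMem.2 ?_
      rintro j ⟨n, -, h'⟩
      obtain ⟨p, hp, hlt⟩ := hn n
      exact absurd (h' p hp) (not_le.2 hlt)
    rw [splitRank, hempty, sInf_empty]
  · rintro ⟨n, hn⟩
    have : splitRank k r f α γ ≤ n := sInf_le ⟨n, rfl, hn⟩
    exact ne_top_of_le_ne_top (ENat.natCast_ne_top n) this

/-- The inequality `1 ≤ ∑ αᵢ sᵢ + (a x₀ + b x₁ + c)` holds on some iterated split closure. -/
def FiniteRank (k : ℕ) (r : Fin k → Pt) (f : Pt) (α : Fin k → ℝ) (a b c : ℝ) : Prop :=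
  ∃ n, ∀ p ∈ closures k r f n, 1 ≤ ∑ i, α i * p.2 i + (a * p.1 0 + b * p.1 1 + c)

theorem splitRank_one_ne_top_iff : splitRank k r f α 1 ≠ ⊤ ↔ FiniteRank k r f α 0 0 0 := by
  simp [splitRank_ne_top_iff, FiniteRank]

theorem convex_setOf_le_sum_add (a b c : ℝ) : Convex ℝ {p : Pt × (Fin k → ℝ) |
    1 ≤ ∑ i, α i * p.2 i + (a * p.1 0 + b * p.1 1 + c)} := by
  intro p hp q hq s t hs ht hst
  simp only [mem_ofPred_eq, Prod.snd_add, Prod.smul_snd, Prod.fst_add, Prod.smul_fst,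
    Pi.add_apply, Pi.smul_apply, smul_eq_mul] at *
  have : ∑ i, α i * (s * p.2 i + t * q.2 i) =
      s * ∑ i, α i * p.2 i + t * ∑ i, α i * q.2 i := by
    rw [Finset.mul_sum, Finset.mul_sum, ← Finset.sum_add_distrib]
    exact Finset.sum_congr rfl fun i _ => by ring
  rw [this]
  have h1 := mul_le_mul_of_nonneg_left hp hs
  have h2 := mul_le_mul_of_nonneg_left hq ht
  have hc : c = s * c + t * c := by rw [← add_mul, hst, one_mul]
  rw [hc]
  linarith

theorem FiniteRank.split {a₁ b₁ c₁ a₂ b₂ c₂ a b c : ℝ} (h₁ : FiniteRank k r f α a₁ b₁ c₁)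
    (h₂ : FiniteRank k r f α a₂ b₂ c₂) (p q m : ℤ)
    (hle : ∀ x y : ℝ, p * x + q * y ≤ m → a₁ * x + b₁ * y + c₁ ≤ a * x + b * y + c)
    (hge : ∀ x y : ℝ, m + 1 ≤ p * x + q * y → a₂ * x + b₂ * y + c₂ ≤ a * x + b * y + c) :
    FiniteRank k r f α a b c := by
  obtain ⟨n₁, h₁⟩ := h₁
  obtain ⟨n₂, h₂⟩ := h₂
  refine ⟨max n₁ n₂ + 1, fun z hz =>
    splitClosure_subset_of_convex (convex_setOf_le_sum_add a b c) p q m ?_ ?_ hz⟩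
  · intro z hz h
    have := h₁ z (closures_antitone (le_max_left _ _) hz)
    have := hle _ _ h
    simp only [mem_ofPred_eq]
    linarith
  · intro z hz h
    have := h₂ z (closures_antitone (le_max_right _ _) hz)
    have := hge _ _ h
    simp only [mem_ofPred_eq]
    linarith

theorem FiniteRank.convex_comb {a₁ b₁ c₁ a₂ b₂ c₂ s t : ℝ} (h₁ : FiniteRank k r f α a₁ b₁ c₁)
    (h₂ : FiniteRank k r f α a₂ b₂ c₂) (hs : 0 ≤ s) (ht : 0 ≤ t) (hst : s + t = 1) :
    FiniteRank k r f α (s * a₁ + t * a₂) (s * b₁ + t * b₂) (s * c₁ + t * c₂) := by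
  obtain ⟨n₁, h₁⟩ := h₁
  obtain ⟨n₂, h₂⟩ := h₂
  refine ⟨max n₁ n₂, fun z hz => ?_⟩
  have h1 := mul_le_mul_of_nonneg_left (h₁ z (closures_antitone (le_max_left _ _) hz)) hs
  have h2 := mul_le_mul_of_nonneg_left (h₂ z (closures_antitone (le_max_right _ _) hz)) ht
  obtain rfl : t = 1 - s := by linarith
  linarith

end Basics

section InfiniteRank

variable {k : ℕ} {r : Fin k → Pt} {f : Pt} {α : Fin k → ℝ}

theorem IsIntPt.exists_int {x : Pt} (hx : IsIntPt x) (a b : ℤ) :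
    ∃ m : ℤ, (a : ℝ) * x 0 + b * x 1 = m := by
  obtain ⟨y, hy⟩ := hx 0
  obtain ⟨z, hz⟩ := hx 1
  exact ⟨a * y + b * z, by rw [hy, hz]; push_cast; ring⟩

theorem IsIntPt.le_or_add_one_le {x : Pt} (hx : IsIntPt x) (a b c : ℤ) :
    (a : ℝ) * x 0 + b * x 1 ≤ c ∨ (c : ℝ) + 1 ≤ a * x 0 + b * x 1 := by
  obtain ⟨m, hm⟩ := hx.exists_int a b
  rw [hm]
  rcases le_or_gt m c with h | h
  · exact Or.inl (by exact_mod_cast h)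
  · exact Or.inr (by exact_mod_cast h)

theorem mem_convexHull_split_of_midpoints {C : Set (Pt × (Fin k → ℝ))} (hC : Convex ℝ C)
    {p V₀ V₁ V₂ : Pt × (Fin k → ℝ)} {a b c : ℤ} (hp : p ∈ C) (h₀ : V₀ ∈ C)
    (hpx : ∀ j, p.1 j = (V₀.1 j + V₁.1 j + V₂.1 j) / 3)
    (hM : (1 / 2 : ℝ) • V₁ + (1 / 2 : ℝ) • V₂ ∈ C)
    (hside : (a : ℝ) * ((V₁.1 0 + V₂.1 0) / 2) + b * ((V₁.1 1 + V₂.1 1) / 2) ≤ c ∨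
      (c : ℝ) + 1 ≤ a * ((V₁.1 0 + V₂.1 0) / 2) + b * ((V₁.1 1 + V₂.1 1) / 2))
    (hsame : ((a : ℝ) * ((V₀.1 0 + V₁.1 0) / 2) + b * ((V₀.1 1 + V₁.1 1) / 2) ≤ c ∧
        (a : ℝ) * ((V₀.1 0 + V₂.1 0) / 2) + b * ((V₀.1 1 + V₂.1 1) / 2) ≤ c) ∨
      ((c : ℝ) + 1 ≤ a * ((V₀.1 0 + V₁.1 0) / 2) + b * ((V₀.1 1 + V₁.1 1) / 2) ∧
        (c : ℝ) + 1 ≤ a * ((V₀.1 0 + V₂.1 0) / 2) + b * ((V₀.1 1 + V₂.1 1) / 2))) :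
    (1 / 2 : ℝ) • p + (1 / 6 : ℝ) • (V₀ + V₁ + V₂) ∈ convexHull ℝ
      ((C ∩ {p | (a : ℝ) * p.1 0 + b * p.1 1 ≤ c}) ∪
        (C ∩ {p | (c : ℝ) + 1 ≤ a * p.1 0 + b * p.1 1})) := by
  have hq : (3 / 4 : ℝ) • p + (1 / 4 : ℝ) • V₀ ∈ C :=
    hC hp h₀ (by norm_num) (by norm_num) (by norm_num)
  have heq : (1 / 2 : ℝ) • p + (1 / 6 : ℝ) • (V₀ + V₁ + V₂) =
      (1 / 3 : ℝ) • ((1 / 2 : ℝ) • V₁ + (1 / 2 : ℝ) • V₂) +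
        (2 / 3 : ℝ) • ((3 / 4 : ℝ) • p + (1 / 4 : ℝ) • V₀) := by module
  rw [heq]
  refine convex_convexHull ℝ _ (subset_convexHull ℝ _ ?_) (subset_convexHull ℝ _ ?_)
    (by norm_num) (by norm_num) (by norm_num)
  · refine hside.imp (fun h => ⟨hM, ?_⟩) (fun h => ⟨hM, ?_⟩)
    all_goals
      simp only [mem_ofPred_eq, Prod.fst_add, Prod.smul_fst, Pi.add_apply, Pi.smul_apply,
        smul_eq_mul]
      linarith
  · refine hsame.imp (fun h => ⟨hq, ?_⟩) (fun h => ⟨hq, ?_⟩)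
    all_goals
      simp only [mem_ofPred_eq, Prod.fst_add, Prod.smul_fst, Pi.add_apply, Pi.smul_apply,
        smul_eq_mul, hpx]
      linarith [h.1, h.2]

theorem half_add_sixth_mem_closures_succ {p V₀ V₁ V₂ : Pt × (Fin k → ℝ)} {n : ℕ}
    (hp : p ∈ closures k r f n) (h₀ : V₀ ∈ mixedP k r f) (h₁ : V₁ ∈ mixedP k r f)
    (h₂ : V₂ ∈ mixedP k r f) (hpx : ∀ j, p.1 j = (V₀.1 j + V₁.1 j + V₂.1 j) / 3)
    (h₀₁ : (1 / 2 : ℝ) • V₀ + (1 / 2 : ℝ) • V₁ ∈ mixedP k r f)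
    (h₀₂ : (1 / 2 : ℝ) • V₀ + (1 / 2 : ℝ) • V₂ ∈ mixedP k r f)
    (h₁₂ : (1 / 2 : ℝ) • V₁ + (1 / 2 : ℝ) • V₂ ∈ mixedP k r f) :
    (1 / 2 : ℝ) • p + (1 / 6 : ℝ) • (V₀ + V₁ + V₂) ∈ closures k r f (n + 1) := by
  have hsub := mixedP_subset_closures (k := k) (r := r) (f := f) n
  have hC := convex_closures (k := k) (r := r) (f := f) n
  refine mem_splitClosure fun a b c => ?_
  have s₀₁ := h₀₁.1.le_or_add_one_le a b c
  have s₀₂ := h₀₂.1.le_or_add_one_le a b c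
  have s₁₂ := h₁₂.1.le_or_add_one_le a b c
  have half : ∀ (U W : Pt × (Fin k → ℝ)) (j : Fin 2),
      ((1 / 2 : ℝ) • U + (1 / 2 : ℝ) • W).1 j = (U.1 j + W.1 j) / 2 := by
    intro U W j
    simp only [Prod.fst_add, Prod.smul_fst, Pi.add_apply, Pi.smul_apply, smul_eq_mul]
    ring
  simp only [half] at s₀₁ s₀₂ s₁₂
  have key₀ := mem_convexHull_split_of_midpoints (a := a) (b := b) (c := c) hC hp (hsub h₀) hpx
    (hsub h₁₂) s₁₂
  have key₁ := mem_convexHull_split_of_midpoints (a := a) (b := b) (c := c) (V₁ := V₀) (V₂ := V₂)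
    hC hp (hsub h₁) (fun j => by rw [hpx]; ring) (hsub h₀₂) s₀₂
  have key₂ := mem_convexHull_split_of_midpoints (a := a) (b := b) (c := c) (V₁ := V₀) (V₂ := V₁)
    hC hp (hsub h₂) (fun j => by rw [hpx]; ring) (hsub h₀₁) s₀₁
  have e₁ : V₁ + V₀ + V₂ = V₀ + V₁ + V₂ := by abel
  have e₂ : V₂ + V₀ + V₁ = V₀ + V₁ + V₂ := by abel
  rw [e₁, add_comm (V₁.1 0), add_comm (V₁.1 1)] at key₁
  rw [e₂, add_comm (V₂.1 0) (V₀.1 0), add_comm (V₂.1 1) (V₀.1 1), add_comm (V₂.1 0) (V₁.1 0),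
    add_comm (V₂.1 1) (V₁.1 1)] at key₂
  rcases s₀₁ with s₀₁ | s₀₁ <;> rcases s₀₂ with s₀₂ | s₀₂
  · exact key₀ (Or.inl ⟨s₀₁, s₀₂⟩)
  · rcases s₁₂ with s₁₂ | s₁₂
    · exact key₁ (Or.inl ⟨s₀₁, s₁₂⟩)
    · exact key₂ (Or.inr ⟨s₀₂, s₁₂⟩)
  · rcases s₁₂ with s₁₂ | s₁₂
    · exact key₂ (Or.inl ⟨s₀₂, s₁₂⟩)
    · exact key₁ (Or.inr ⟨s₀₁, s₁₂⟩)
  · exact key₀ (Or.inr ⟨s₀₁, s₀₂⟩)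

theorem mixedP_midpoint {U W : Pt × (Fin k → ℝ)} (hU : U ∈ mixedP k r f) (hW : W ∈ mixedP k r f)
    (h : IsIntPt ((1 / 2 : ℝ) • U.1 + (1 / 2 : ℝ) • W.1)) :
    (1 / 2 : ℝ) • U + (1 / 2 : ℝ) • W ∈ mixedP k r f :=
  ⟨h, convex_relaxP hU.2 hW.2 (by norm_num) (by norm_num) (by norm_num)⟩

theorem isIntPt_midpoint {x y : Pt} (hx : IsIntPt x) (hy : IsIntPt y)
    (h : ∃! z, z ∈ openSegment ℝ x y ∧ IsIntPt z) :
    IsIntPt ((1 / 2 : ℝ) • x + (1 / 2 : ℝ) • y) := by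
  obtain ⟨z, ⟨⟨s, t, hs, ht, hst, rfl⟩, hz⟩, huniq⟩ := h
  have h2 := huniq (t • x + s • y) ⟨⟨t, s, ht, hs, by linarith, rfl⟩, fun j => ?_⟩
  · have : (1 / 2 : ℝ) • x + (1 / 2 : ℝ) • y = s • x + t • y := by
      calc (1 / 2 : ℝ) • x + (1 / 2 : ℝ) • y
          = (1 / 2 : ℝ) • ((s + t) • x + (s + t) • y) := by rw [hst]; module
        _ = (1 / 2 : ℝ) • ((s • x + t • y) + (t • x + s • y)) := by module
        _ = s • x + t • y := by rw [h2]; module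
    rw [this]; exact hz
  · obtain ⟨a, ha⟩ := hx j
    obtain ⟨b, hb⟩ := hy j
    obtain ⟨c, hc⟩ := hz j
    refine ⟨a + b - c, ?_⟩
    push_cast
    rw [← ha, ← hb, ← hc]
    simp only [Pi.add_apply, Pi.smul_apply, smul_eq_mul]
    obtain rfl : t = 1 - s := by linarith
    ring

theorem AffineIndependent.mem_extremePoints_convexHull_range {v : Fin 3 → Pt}
    (hv : AffineIndependent ℝ v) (i : Fin 3) :
    v i ∈ (convexHull ℝ (range v)).extremePoints ℝ := by
  have htop : affineSpan ℝ (range v) = ⊤ :=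
    hv.affineSpan_eq_top_iff_card_eq_finrank_add_one.2 (by simp)
  let b : AffineBasis (Fin 3) ℝ Pt := ⟨v, hv, htop⟩
  have hb : (b : Fin 3 → Pt) = v := rfl
  have hS : convexHull ℝ (range v) = {x | ∀ i, 0 ≤ b.coord i x} :=
    hb ▸ b.convexHull_eq_nonneg_coord
  rw [mem_extremePoints]
  refine ⟨subset_convexHull ℝ _ ⟨i, rfl⟩, ?_⟩
  rintro x hx y hy ⟨s, t, hs, ht, hst, hxy⟩
  rw [hS] at hx hy
  have key : ∀ j, s * b.coord j x + t * b.coord j y = b.coord j (v i) := by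
    intro j
    rw [← hxy, Convex.combo_affine_apply hst]
    simp
  have hzero : ∀ j, j ≠ i → b.coord j x = 0 ∧ b.coord j y = 0 := by
    intro j hj
    have h := key j
    have hvi : b.coord j (v i) = 0 := b.coord_apply_ne hj
    rw [hvi] at h
    have h1 := mul_nonneg hs.le (hx j)
    have h2 := mul_nonneg ht.le (hy j)
    constructor
    · exact (mul_eq_zero.1 (by linarith : s * b.coord j x = 0)).resolve_left hs.ne'
    · exact (mul_eq_zero.1 (by linarith : t * b.coord j y = 0)).resolve_left ht.ne'
  have huniq : ∀ z, (∀ j, j ≠ i → b.coord j z = 0) → z = v i := by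
    intro z hz
    refine b.ext_elem fun j => ?_
    rcases eq_or_ne j i with rfl | hj
    · have hsum := b.sum_coord_apply_eq_one z
      rw [Finset.sum_eq_single j (fun l _ hl => hz l hl) (by simp)] at hsum
      rw [hsum]
      exact (b.coord_apply_eq j).symm
    · rw [hz j hj]
      exact (b.coord_apply_ne hj).symm
  exact ⟨huniq x fun j hj => (hzero j hj).1, huniq y fun j hj => (hzero j hj).2⟩

theorem zero_mem_coneGen (S : Set Pt) : (0 : Pt) ∈ coneGen S :=
  ⟨0, 0, 0, by simp, by simp, by simp⟩

theorem smul_mem_coneGen {S : Set Pt} {x : Pt} (hx : x ∈ coneGen S) {t : ℝ} (ht : 0 ≤ t) :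
    t • x ∈ coneGen S := by
  obtain ⟨n, c, v, hc, hv, rfl⟩ := hx
  exact ⟨n, fun j => t * c j, v, fun j => mul_nonneg ht (hc j), hv, by
    simp [Finset.smul_sum, smul_smul]⟩

theorem exists_eq_of_mem_extremePoints_inducedSet {x : Pt}
    (hx : x ∈ (inducedSet k r f α).extremePoints ℝ) (hxf : x ≠ f) :
    ∃ i, 0 < α i ∧ x = f + (α i)⁻¹ • r i := by
  obtain ⟨y, hy, c, hc, hxy⟩ := hx.1
  dsimp only at hxy
  have h0 : y ∈ inducedSet k r f α := ⟨y, hy, 0, zero_mem_coneGen _, by simp⟩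
  have h2 : y + (2 : ℝ) • c ∈ inducedSet k r f α :=
    ⟨y, hy, _, smul_mem_coneGen hc (by norm_num), rfl⟩
  have hyx : y = x := (mem_extremePoints.1 hx).2 _ h0 _ h2
    ⟨1 / 2, 1 / 2, by norm_num, by norm_num, by norm_num, by rw [← hxy]; module⟩ |>.1
  have hsub : convexHull ℝ ({f} ∪ {x | ∃ i, 0 < α i ∧ x = f + (α i)⁻¹ • r i}) ⊆
      inducedSet k r f α := fun z hz => ⟨z, hz, 0, zero_mem_coneGen _, by simp⟩
  have hx' := inter_extremePoints_subset_extremePoints_of_subset hsub ⟨hyx ▸ hy, hx⟩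
  rcases extremePoints_convexHull_subset hx' with h | h
  · exact absurd h hxf
  · exact h

theorem base_mem_inducedSet : f ∈ inducedSet k r f α :=
  ⟨f, subset_convexHull ℝ _ (Or.inl rfl), 0, zero_mem_coneGen _, by simp⟩

theorem not_finiteRank_of_isT1 (hf : ¬ IsIntPt f) (hT : IsT1 (inducedSet k r f α)) :
    ¬ FiniteRank k r f α 0 0 0 := by
  obtain ⟨v, hv, hint, hS, hseg⟩ := hT
  have hm : ∀ i, ∃ m, 0 < α m ∧ v i = f + (α m)⁻¹ • r m := fun i =>
    exists_eq_of_mem_extremePoints_inducedSet (hS ▸ hv.mem_extremePoints_convexHull_range i)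
      (fun h => hf (h ▸ hint i))
  choose m hm hvm using hm
  obtain ⟨l, hl, hl1, hlf⟩ : ∃ l : Fin 3 → ℝ, (∀ i, 0 ≤ l i) ∧ ∑ i, l i = 1 ∧
      ∑ i, l i • v i = f := by
    have hfS : f ∈ convexHull ℝ (range v) := hS ▸ base_mem_inducedSet
    let b : AffineBasis (Fin 3) ℝ Pt :=
      ⟨v, hv, hv.affineSpan_eq_top_iff_card_eq_finrank_add_one.2 (by simp)⟩
    have hb : convexHull ℝ (range v) = {x | ∀ i, 0 ≤ b.coord i x} := b.convexHull_eq_nonneg_coord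
    rw [hb] at hfS
    exact ⟨fun i => b.coord i f, hfS, b.sum_coord_apply_eq_one f,
      b.linear_combination_coord_eq_self f⟩
  have hl' : ∀ i, l i ≤ 1 := fun i => hl1 ▸ Finset.single_le_sum (fun j _ => hl j)
    (Finset.mem_univ i)
  let V : Fin 3 → Pt × (Fin k → ℝ) := fun i => (v i, Pi.single (m i) (α (m i))⁻¹)
  have hRV : ∀ i, ∑ j, (V i).2 j • r j = v i - f := by
    intro i
    rw [Finset.sum_eq_single (m i) (fun j _ hj => by simp [V, Pi.single_eq_of_ne hj]) (by simp)]
    simp [V, hvm i]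
  have hαV : ∀ i, ∑ j, α j * (V i).2 j = 1 := by
    intro i
    rw [Finset.sum_eq_single (m i) (fun j _ hj => by simp [V, Pi.single_eq_of_ne hj]) (by simp)]
    simp [V, (hm i).ne']
  have hV0 : ∀ i j, 0 ≤ (V i).2 j := by
    intro i
    have : (0 : Fin k → ℝ) ≤ Pi.single (m i) (α (m i))⁻¹ :=
      Pi.single_nonneg.2 (inv_nonneg.2 (hm i).le)
    exact this
  have hV : ∀ i, V i ∈ mixedP k r f := fun i => ⟨hint i, hV0 i, by rw [hRV]; simp [V]⟩
  have hVmid : ∀ i j, i ≠ j → (1 / 2 : ℝ) • V i + (1 / 2 : ℝ) • V j ∈ mixedP k r f :=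
    fun i j hij => mixedP_midpoint (hV i) (hV j) (isIntPt_midpoint (hint i) (hint j) (hseg i j hij))
  have key : ∀ n, ∃ p ∈ closures k r f n, (∀ j, p.1 j = ((V 0).1 j + (V 1).1 j + (V 2).1 j) / 3) ∧
      ∑ i, α i * p.2 i < 1 := by
    intro n
    induction n with
    | zero =>
      refine ⟨((1 / 3 : ℝ) • (v 0 + v 1 + v 2), ∑ i, ((1 - l i) / 3) • (V i).2),
        ⟨fun j => ?_, ?_⟩, fun j => ?_, ?_⟩
      · simp only [Finset.sum_apply, Pi.smul_apply, smul_eq_mul]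
        exact Finset.sum_nonneg fun i _ => mul_nonneg (by linarith [hl' i]) (hV0 i j)
      · have h1 : ∑ j, (∑ i, ((1 - l i) / 3) • (V i).2) j • r j =
            ∑ i, ((1 - l i) / 3) • (v i - f) := by
          simp only [← hRV, Finset.smul_sum, Finset.sum_apply, Finset.sum_smul, Pi.smul_apply,
            smul_smul, smul_eq_mul]
          exact Finset.sum_comm
        dsimp only
        rw [h1]
        simp only [Fin.sum_univ_three] at hl1 hlf ⊢
        have h3 : ((1 - l 0) / 3) • (v 0 - f) + ((1 - l 1) / 3) • (v 1 - f) +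
            ((1 - l 2) / 3) • (v 2 - f) = (1 / 3 : ℝ) • (v 0 + v 1 + v 2) -
            (1 / 3 : ℝ) • (l 0 • v 0 + l 1 • v 1 + l 2 • v 2) -
            ((3 - (l 0 + l 1 + l 2)) / 3) • f := by module
        rw [h3, hl1, hlf]
        module
      · simp [V]; ring
      · have h1 : ∑ j, α j * (∑ i, ((1 - l i) / 3) • (V i).2) j =
            ∑ i, ((1 - l i) / 3) * ∑ j, α j * (V i).2 j := by
          simp only [Finset.mul_sum, Finset.sum_apply, Pi.smul_apply, smul_eq_mul]
          rw [Finset.sum_comm]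
          exact Finset.sum_congr rfl fun i _ => Finset.sum_congr rfl fun j _ => by ring
        dsimp only
        rw [h1]
        simp only [hαV, Fin.sum_univ_three] at hl1 ⊢
        linarith
    | succ n ih =>
      obtain ⟨p, hp, hpx, hlt⟩ := ih
      refine ⟨_, half_add_sixth_mem_closures_succ hp (hV 0) (hV 1) (hV 2) hpx
        (hVmid 0 1 (by decide)) (hVmid 0 2 (by decide)) (hVmid 1 2 (by decide)), fun j => ?_, ?_⟩
      · simp only [Prod.fst_add, Prod.smul_fst, Pi.add_apply, Pi.smul_apply, smul_eq_mul, hpx]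
        ring
      · have : ∑ i, α i * ((1 / 2 : ℝ) • p + (1 / 6 : ℝ) • (V 0 + V 1 + V 2)).2 i =
            (1 / 2) * ∑ i, α i * p.2 i + (1 / 6) * (∑ i, α i * (V 0).2 i + ∑ i, α i * (V 1).2 i +
              ∑ i, α i * (V 2).2 i) := by
          simp only [← Finset.sum_add_distrib, Finset.mul_sum]
          refine Finset.sum_congr rfl fun i _ => ?_
          simp only [Prod.snd_add, Prod.smul_snd, Pi.add_apply, Pi.smul_apply, smul_eq_mul]
          ring
        rw [this, hαV, hαV, hαV]
        linarith
  rintro ⟨n, hn⟩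
  obtain ⟨p, hp, -, hlt⟩ := key n
  have := hn p hp
  linarith

end InfiniteRank

section ZeroCoefficient

variable {k : ℕ} {r : Fin k → Pt} {f : Pt} {α : Fin k → ℝ}

theorem IsRatPt.exists_coprime_direction {x : Pt} (hx : IsRatPt x) (h0 : x ≠ 0) :
    ∃ (e₁ e₂ u v : ℤ) (c : ℝ), 0 < c ∧ u * e₁ + v * e₂ = 1 ∧ x 0 = c * e₁ ∧ x 1 = c * e₂ := by
  obtain ⟨q₀, h₀⟩ := hx 0
  obtain ⟨q₁, h₁⟩ := hx 1
  have d₀ : (0 : ℝ) < q₀.den := by exact_mod_cast q₀.pos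
  have d₁ : (0 : ℝ) < q₁.den := by exact_mod_cast q₁.pos
  set A : ℤ := q₀.num * q₁.den with hA
  set B : ℤ := q₁.num * q₀.den with hB
  have hAx : x 0 * (q₀.den * q₁.den) = A := by
    rw [h₀, hA]
    have : (q₀ : ℝ) = q₀.num / q₀.den := by exact_mod_cast (Rat.num_div_den q₀).symm
    rw [this]; push_cast; field_simp
  have hBx : x 1 * (q₀.den * q₁.den) = B := by
    rw [h₁, hB]
    have : (q₁ : ℝ) = q₁.num / q₁.den := by exact_mod_cast (Rat.num_div_den q₁).symm
    rw [this]; push_cast; field_simp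
  have hg : 0 < Int.gcd A B := by
    refine Int.gcd_pos_iff.2 ?_
    by_contra hAB
    push Not at hAB
    rw [hAB.1, Int.cast_zero] at hAx
    rw [hAB.2, Int.cast_zero] at hBx
    apply h0
    ext j
    fin_cases j
    · exact (mul_eq_zero.1 hAx).resolve_right (by positivity)
    · exact (mul_eq_zero.1 hBx).resolve_right (by positivity)
  obtain ⟨e₁, e₂, hco, h1, h2⟩ := Int.exists_gcd_one hg
  obtain ⟨u, v, huv⟩ := Int.isCoprime_iff_gcd_eq_one.2 hco
  refine ⟨e₁, e₂, u, v, Int.gcd A B / (q₀.den * q₁.den), by positivity, huv, ?_, ?_⟩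
  · have h1' : (A : ℝ) = e₁ * (Int.gcd A B : ℝ) := by exact_mod_cast h1
    rw [h1'] at hAx
    field_simp
    linarith
  · have h2' : (B : ℝ) = e₂ * (Int.gcd A B : ℝ) := by exact_mod_cast h2
    rw [h2'] at hBx
    field_simp
    linarith

theorem FiniteRank.of_zero_coefficient (hvalid : ValidIneq k r f α 1) {i₀ : Fin k}
    (hi₀ : α i₀ = 0) (hrat : IsRatPt (r i₀)) (hne : r i₀ ≠ 0) : FiniteRank k r f α 0 0 0 := by
  obtain ⟨e₁, e₂, u, v, c, hc, huv, hr₀, hr₁⟩ := hrat.exists_coprime_direction hne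
  have huv' : (u : ℝ) * e₁ + v * e₂ = 1 := by exact_mod_cast huv
  have hnot : ∀ p ∈ relaxP k r f, ∑ i, α i * p.2 i < 1 → ∀ m : ℤ,
      (-e₂ : ℝ) * p.1 0 + e₁ * p.1 1 ≠ m := by
    rintro ⟨x, s⟩ ⟨hs, hx⟩ hlt m hm
    dsimp only at hs hx hlt hm
    set t : ℝ := u * (x 0 + v * m) + v * (x 1 - u * m) with ht
    obtain ⟨T, hT⟩ := exists_int_gt t
    have hnn : 0 ≤ (T - t) / c := div_nonneg (by linarith) hc.le
    have hmem : ((![-v * m + T * e₁, u * m + T * e₂] : Pt),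
        s + Pi.single i₀ ((T - t) / c)) ∈ mixedP k r f := by
      refine ⟨fun j => ?_, fun i => ?_, ?_⟩
      · fin_cases j
        · exact ⟨-v * m + T * e₁, by simp⟩
        · exact ⟨u * m + T * e₂, by simp⟩
      · have : (0 : Fin k → ℝ) ≤ Pi.single i₀ ((T - t) / c) := Pi.single_nonneg.2 hnn
        exact add_nonneg (hs i) (this i)
      · have hsum : ∑ i, (s + Pi.single i₀ ((T - t) / c) : Fin k → ℝ) i • r i =
            ∑ i, s i • r i + ((T - t) / c) • r i₀ := by
          simp only [Pi.add_apply, add_smul, Finset.sum_add_distrib]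
          congr 1
          rw [Finset.sum_eq_single i₀ (fun j _ hj => by simp [Pi.single_eq_of_ne hj]) (by simp)]
          simp
        dsimp only
        rw [hsum, ← add_assoc, ← hx]
        ext j
        fin_cases j
        · simp only [Fin.zero_eta, Matrix.cons_val_zero, Pi.add_apply, Pi.smul_apply,
            smul_eq_mul, hr₀]
          rw [← mul_assoc, div_mul_cancel₀ _ hc.ne', ht]
          linear_combination (v : ℝ) * hm + x 0 * huv'
        · simp only [Fin.mk_one, Matrix.cons_val_one, Matrix.cons_val_zero, Pi.add_apply,
            Pi.smul_apply, smul_eq_mul, hr₁]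
          rw [← mul_assoc, div_mul_cancel₀ _ hc.ne', ht]
          linear_combination (-(u : ℝ)) * hm + x 1 * huv'
    have h1 := hvalid _ hmem
    have h2 : ∑ i, α i * (s + Pi.single i₀ ((T - t) / c) : Fin k → ℝ) i = ∑ i, α i * s i := by
      simp only [Pi.add_apply, mul_add, Finset.sum_add_distrib, add_eq_left]
      rw [Finset.sum_eq_single i₀ (fun j _ hj => by simp [Pi.single_eq_of_ne hj]) (by simp)]
      simp [hi₀]
    dsimp only at h1
    rw [h2] at h1
    linarith
  have hbase : ((f, 0) : Pt × (Fin k → ℝ)) ∈ relaxP k r f := ⟨fun i => le_rfl, by simp⟩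
  have hcross : ∀ p ∈ relaxP k r f, ∑ i, α i * p.2 i < 1 → ∀ m : ℤ,
      ((-e₂ : ℝ) * f 0 + e₁ * f 1 - m) * ((-e₂ : ℝ) * p.1 0 + e₁ * p.1 1 - m) ≤ 0 → False := by
    intro p hp hlt m hm
    set y : ℝ := (-e₂ : ℝ) * f 0 + e₁ * f 1 - m with hy
    set z : ℝ := (-e₂ : ℝ) * p.1 0 + e₁ * p.1 1 - m with hz
    have hy0 : y ≠ 0 := by
      intro h
      exact hnot _ hbase (by simp) m (by dsimp only; linarith)
    have hyz : y ≠ z := by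
      rintro h
      rw [← h] at hm
      exact absurd hm (not_le.2 (mul_self_pos.2 hy0))
    have hpos : 0 < (y - z) ^ 2 := by
      have := sub_ne_zero.2 hyz
      positivity
    set t : ℝ := y / (y - z) with ht
    have ht0 : 0 ≤ t := by
      have : t = y * (y - z) / (y - z) ^ 2 := by
        rw [ht]; field_simp [sub_ne_zero.2 hyz]
      rw [this]
      exact div_nonneg (by nlinarith [mul_self_nonneg y]) hpos.le
    have ht1 : 0 ≤ 1 - t := by
      have : 1 - t = (-z) * (y - z) / (y - z) ^ 2 := by
        rw [ht]; field_simp [sub_ne_zero.2 hyz]; ring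
      rw [this]
      exact div_nonneg (by nlinarith [mul_self_nonneg z]) hpos.le
    have hmem := convex_relaxP hbase hp ht1 ht0 (by ring)
    have hval : ∑ i, α i * ((1 - t) • ((f, 0) : Pt × (Fin k → ℝ)) + t • p).2 i =
        t * ∑ i, α i * p.2 i := by
      rw [Finset.mul_sum]
      exact Finset.sum_congr rfl fun i _ => by simp; ring
    refine hnot _ hmem ?_ m ?_
    · rw [hval]
      rcases ht0.eq_or_lt with h | h
      · rw [← h]; simp
      · nlinarith
    · have hprod : t * (y - z) = y := by rw [ht]; exact div_mul_cancel₀ _ (sub_ne_zero.2 hyz)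
      simp only [Prod.fst_add, Prod.smul_fst, Pi.add_apply, Pi.smul_apply, smul_eq_mul]
      rw [hy, hz] at hprod
      linarith
  set n : ℤ := ⌊(-e₂ : ℝ) * f 0 + e₁ * f 1⌋ with hn
  have hn1 : (n : ℝ) ≤ -e₂ * f 0 + e₁ * f 1 := Int.floor_le _
  have hn2 : (-e₂ * f 0 + e₁ * f 1 : ℝ) < n + 1 := Int.lt_floor_add_one _
  refine ⟨1, fun z hz => splitClosure_subset_of_convex (convex_setOf_le_sum_add 0 0 0)
    (-e₂) e₁ n ?_ ?_ hz⟩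
  · intro p hp h
    push_cast at h
    simp only [mem_ofPred_eq, zero_mul, add_zero]
    by_contra hlt
    exact hcross p hp (not_le.1 hlt) n (mul_nonpos_of_nonneg_of_nonpos (by linarith) (by linarith))
  · intro p hp h
    push_cast at h
    simp only [mem_ofPred_eq, zero_mul, add_zero]
    by_contra hlt
    refine hcross p hp (not_le.1 hlt) (n + 1) ?_
    push_cast
    exact mul_nonpos_of_nonpos_of_nonneg (by linarith) (by linarith)

end ZeroCoefficient

section Convergence

open Filter Topology

variable {k : ℕ} {r : Fin k → Pt} {f : Pt} {α β : Fin k → ℝ}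

theorem relaxP_ext {p q : Pt × (Fin k → ℝ)} (hp : p ∈ relaxP k r f) (hq : q ∈ relaxP k r f)
    (h : p.2 = q.2) : p = q :=
  Prod.ext (by rw [hp.2, hq.2, h]) h

theorem isClosed_relaxP : IsClosed (relaxP k r f) := by
  refine IsClosed.inter ?_ ?_
  · have : {p : Pt × (Fin k → ℝ) | ∀ i, 0 ≤ p.2 i} = ⋂ i, {p | 0 ≤ p.2 i} := by
      ext; simp
    change IsClosed {p : Pt × (Fin k → ℝ) | ∀ i, 0 ≤ p.2 i}
    rw [this]
    exact isClosed_iInter fun i => isClosed_le (by fun_prop) (by fun_prop)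
  · exact isClosed_eq (by fun_prop) (by fun_prop)

theorem continuous_sum_mul (β : Fin k → ℝ) :
    Continuous fun p : Pt × (Fin k → ℝ) => ∑ i, β i * p.2 i := by fun_prop

theorem sum_mul_combo (β : Fin k → ℝ) (s t : ℝ) (p q : Pt × (Fin k → ℝ)) :
    ∑ i, β i * (s • p + t • q).2 i = s * ∑ i, β i * p.2 i + t * ∑ i, β i * q.2 i := by
  rw [Finset.mul_sum, Finset.mul_sum, ← Finset.sum_add_distrib]
  exact Finset.sum_congr rfl fun i _ => by simp; ring

theorem isCompact_relaxP_inter_le (hβ : ∀ i, 0 < β i) (γ : ℝ) :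
    IsCompact (relaxP k r f ∩ {p | ∑ i, β i * p.2 i ≤ γ}) := by
  have hK : IsCompact ((fun s : Fin k → ℝ => ((f + ∑ i, s i • r i, s) : Pt × (Fin k → ℝ))) ''
      Icc 0 (fun i => γ / β i)) := isCompact_Icc.image (by fun_prop)
  refine hK.of_isClosed_subset
    (isClosed_relaxP.inter (isClosed_le (continuous_sum_mul β) continuous_const)) ?_
  rintro p ⟨hp, hpγ⟩
  refine ⟨p.2, ⟨hp.1, fun i => ?_⟩, Prod.ext hp.2.symm rfl⟩
  rw [le_div_iff₀ (hβ i), mul_comm]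
  exact (Finset.single_le_sum (f := fun i => β i * p.2 i)
    (fun j _ => mul_nonneg (hβ j).le (hp.1 j)) (Finset.mem_univ i)).trans hpγ

theorem exists_combo_of_mem_splitClosure {C : Set (Pt × (Fin k → ℝ))} (hC : Convex ℝ C)
    {q : Pt × (Fin k → ℝ)} (hq : q ∈ splitClosure k C) (a b c : ℤ) :
    ∃ l : ℝ, 0 ≤ l ∧ l ≤ 1 ∧ ∃ x ∈ C, ∃ y ∈ C, q = l • x + (1 - l) • y ∧
      l * (a * x.1 0 + b * x.1 1) ≤ l * c ∧
      (1 - l) * (c + 1) ≤ (1 - l) * (a * y.1 0 + b * y.1 1) := by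
  have hlin : IsLinearMap ℝ fun p : Pt × (Fin k → ℝ) => (a : ℝ) * p.1 0 + b * p.1 1 :=
    { map_add := fun x y => by simp only [Prod.fst_add, Pi.add_apply]; ring
      map_smul := fun t x => by
        simp only [Prod.smul_fst, Pi.smul_apply, smul_eq_mul]; ring }
  have hL : Convex ℝ (C ∩ {p | (a : ℝ) * p.1 0 + b * p.1 1 ≤ c}) :=
    hC.inter (convex_halfSpace_le hlin _)
  have hR : Convex ℝ (C ∩ {p | (c : ℝ) + 1 ≤ a * p.1 0 + b * p.1 1}) :=
    hC.inter (convex_halfSpace_ge hlin _)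
  have hmem : q ∈ convexHull ℝ ((C ∩ {p | (a : ℝ) * p.1 0 + b * p.1 1 ≤ c}) ∪
      (C ∩ {p | (c : ℝ) + 1 ≤ a * p.1 0 + b * p.1 1})) := by
    have := mem_iInter.1 (mem_iInter.1 hq ![a, b]) c
    simpa [Fin.sum_univ_two] using this
  rcases (C ∩ {p | (a : ℝ) * p.1 0 + b * p.1 1 ≤ c}).eq_empty_or_nonempty with hLe | hLn
  · rw [hLe, empty_union, hR.convexHull_eq] at hmem
    exact ⟨0, le_rfl, zero_le_one, q, hmem.1, q, hmem.1, by simp, by simp, by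
      simpa using hmem.2⟩
  rcases (C ∩ {p | (c : ℝ) + 1 ≤ a * p.1 0 + b * p.1 1}).eq_empty_or_nonempty with hRe | hRn
  · rw [hRe, union_empty, hL.convexHull_eq] at hmem
    exact ⟨1, zero_le_one, le_rfl, q, hmem.1, q, hmem.1, by simp, by simpa using hmem.2, by simp⟩
  rw [hL.convexHull_union hR hLn hRn, mem_convexJoin] at hmem
  obtain ⟨x, hx, y, hy, s, t, hs, ht, hst, rfl⟩ := hmem
  obtain rfl : t = 1 - s := by linarith
  exact ⟨s, hs, by linarith, x, hx.1, y, hy.1, rfl, mul_le_mul_of_nonneg_left hx.2 hs,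
    mul_le_mul_of_nonneg_left hy.2 ht⟩

theorem exists_tendsto_of_tendsto_smul {l : ℕ → ℝ} {L : ℝ} (hl : Tendsto l atTop (𝓝 L))
    (hL : 0 < L) {φ : ℕ → ℕ} (hφ : StrictMono φ) {x : ℕ → Pt × (Fin k → ℝ)}
    (hx : ∀ n, x n ∈ closures k r f (φ n)) {u : Fin k → ℝ}
    (hu : Tendsto (fun n => l n • (x n).2) atTop (𝓝 u)) :
    ∃ y, Tendsto x atTop (𝓝 y) ∧ (∀ m, y ∈ closure (closures k r f m)) ∧ L • y.2 = u := by
  have h2 : Tendsto (fun n => (x n).2) atTop (𝓝 (L⁻¹ • u)) := by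
    have h := (hl.inv₀ hL.ne').smul hu
    refine h.congr' ?_
    filter_upwards [hl.eventually (lt_mem_nhds hL)] with n hn
    rw [smul_smul, inv_mul_cancel₀ hn.ne', one_smul]
  have hF : Continuous fun s : Fin k → ℝ => ((f + ∑ i, s i • r i, s) : Pt × (Fin k → ℝ)) := by
    fun_prop
  have h3 : Tendsto x atTop (𝓝 (f + ∑ i, (L⁻¹ • u) i • r i, L⁻¹ • u)) := by
    refine ((hF.tendsto _).comp h2).congr fun n => ?_
    exact Prod.ext (closures_subset_relaxP _ (hx n)).2.symm rfl
  refine ⟨_, h3, fun m => ?_, by simp [smul_smul, hL.ne']⟩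
  refine mem_closure_of_tendsto h3 ?_
  filter_upwards [eventually_ge_atTop m] with n hn
  exact closures_antitone (hn.trans (hφ.le_apply)) (hx n)

theorem exists_closures_le (hβ : ∀ i, 0 < β i) {γ : ℝ}
    (hγ : ∀ p ∈ mixedP k r f, γ < ∑ i, β i * p.2 i) :
    ∃ n, ∀ p ∈ closures k r f n, γ ≤ ∑ i, β i * p.2 i := by
  by_contra hcon
  push Not at hcon
  let K : ℕ → Set (Pt × (Fin k → ℝ)) := fun n =>
    closure (closures k r f n) ∩ {p | ∑ i, β i * p.2 i ≤ γ}
  have hcl : ∀ n, closure (closures k r f n) ⊆ relaxP k r f := fun n =>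
    closure_minimal (closures_subset_relaxP n) isClosed_relaxP
  have hclosed : ∀ n, IsClosed (K n) := fun n =>
    isClosed_closure.inter (isClosed_le (continuous_sum_mul β) continuous_const)
  have hcomp : ∀ n, IsCompact (K n) := fun n =>
    (isCompact_relaxP_inter_le hβ γ).of_isClosed_subset (hclosed n)
      (inter_subset_inter_left _ (hcl n))
  have hne : (⋂ n, K n).Nonempty := by
    refine IsCompact.nonempty_iInter_of_sequence_nonempty_isCompact_isClosed K (fun n => ?_)
      (fun n => ?_) (hcomp 0) hclosed
    · exact inter_subset_inter_left _ (closure_mono (closures_succ_subset n))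
    · obtain ⟨p, hp, hlt⟩ := hcon n
      exact ⟨p, subset_closure hp, hlt.le⟩
  have hKc : IsCompact (⋂ n, K n) :=
    (hcomp 0).of_isClosed_subset (isClosed_iInter hclosed) (iInter_subset _ 0)
  obtain ⟨p₀, hp₀, hmin⟩ := hKc.exists_isMinOn hne (continuous_sum_mul β).continuousOn
  set M : ℝ := ∑ i, β i * p₀.2 i with hM
  have hMγ : M ≤ γ := (mem_iInter.1 hp₀ 0).2
  have hlow : ∀ y, (∀ m, y ∈ closure (closures k r f m)) → M ≤ ∑ i, β i * y.2 i := by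
    intro y hy
    by_cases h : ∑ i, β i * y.2 i ≤ γ
    · exact hmin (mem_iInter.2 fun n => ⟨hy n, h⟩)
    · exact hMγ.trans (not_le.1 h).le
  let K' : Set (Pt × (Fin k → ℝ)) := (⋂ n, K n) ∩ {p | ∑ i, β i * p.2 i = M}
  have hK'c : IsCompact K' :=
    hKc.inter_right (isClosed_eq (continuous_sum_mul β) continuous_const)
  obtain ⟨p, hp⟩ := hK'c.extremePoints_nonempty ⟨p₀, hp₀, rfl⟩
  have hpcl : ∀ n, p ∈ closure (closures k r f n) := fun n => (mem_iInter.1 hp.1.1 n).1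
  have hpM : ∑ i, β i * p.2 i = M := hp.1.2
  have hprel : p ∈ relaxP k r f := hcl 0 (hpcl 0)
  by_cases hint : IsIntPt p.1
  · have := hγ p ⟨hint, hprel⟩
    linarith
  obtain ⟨a, b, c, hc1, hc2⟩ : ∃ a b c : ℤ, (c : ℝ) < a * p.1 0 + b * p.1 1 ∧
      (a : ℝ) * p.1 0 + b * p.1 1 < c + 1 := by
    have aux : ∀ x : ℝ, (¬ ∃ z : ℤ, x = z) → (⌊x⌋ : ℝ) < x ∧ x < ⌊x⌋ + 1 := fun x hx =>
      ⟨lt_of_le_of_ne (Int.floor_le x) fun h => hx ⟨_, h.symm⟩, Int.lt_floor_add_one x⟩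
    simp only [IsIntPt, not_forall] at hint
    obtain ⟨j, hj⟩ := hint
    fin_cases j
    · exact ⟨1, 0, ⌊p.1 0⌋, by simpa using aux _ hj⟩
    · exact ⟨0, 1, ⌊p.1 1⌋, by simpa using aux _ hj⟩
  have hq : ∀ n : ℕ, ∃ q ∈ closures k r f (n + 1), dist p q < 1 / (n + 1) := fun n =>
    Metric.mem_closure_iff.1 (hpcl (n + 1)) _ (by positivity)
  choose q hqC hqd using hq
  have hqlim : Tendsto q atTop (𝓝 p) := by
    rw [tendsto_iff_dist_tendsto_zero]
    refine squeeze_zero (fun _ => dist_nonneg) (fun n => ?_)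
      tendsto_one_div_add_atTop_nhds_zero_nat
    rw [dist_comm]
    exact (hqd n).le
  choose l hl0 hl1 x hx y hy hqxy hxc hyc using fun n =>
    exists_combo_of_mem_splitClosure (convex_closures n) (hqC n) a b c
  have hx0 : ∀ n i, 0 ≤ (l n • (x n).2) i := fun n i =>
    mul_nonneg (hl0 n) ((closures_subset_relaxP _ (hx n)).1 i)
  have hy0 : ∀ n i, 0 ≤ ((1 - l n) • (y n).2) i := fun n i =>
    mul_nonneg (by linarith [hl1 n]) ((closures_subset_relaxP _ (hy n)).1 i)
  have hsum : ∀ n, (q n).2 = l n • (x n).2 + (1 - l n) • (y n).2 := fun n => by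
    rw [hqxy n]; rfl
  have hqB : ∀ n i, (q n).2 i ≤ p.2 i + 1 := by
    intro n i
    have h1 : dist ((q n).2 i) (p.2 i) ≤ dist (q n) p :=
      (dist_le_pi_dist (q n).2 p.2 i).trans (le_max_right _ _)
    have h2 : dist (q n) p < 1 := by
      rw [dist_comm]
      refine (hqd n).trans_le ?_
      rw [div_le_one (by positivity)]
      have : (0 : ℝ) ≤ n := n.cast_nonneg
      linarith
    have h3 := le_abs_self ((q n).2 i - p.2 i)
    rw [Real.dist_eq] at h1
    linarith
  let B : Fin k → ℝ := fun i => p.2 i + 1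
  have hcompact : IsCompact (Icc (0 : ℝ) 1 ×ˢ (Icc 0 B ×ˢ Icc 0 B)) :=
    isCompact_Icc.prod (isCompact_Icc.prod isCompact_Icc)
  obtain ⟨⟨L, u, w⟩, ⟨⟨hL0, hL1⟩, hu, hw⟩, φ, hφ, hlim⟩ := hcompact.tendsto_subseq
    (x := fun n => (l n, l n • (x n).2, (1 - l n) • (y n).2)) (fun n => by
      refine ⟨⟨hl0 n, hl1 n⟩, ⟨hx0 n, fun i => ?_⟩, hy0 n, fun i => ?_⟩
      · have h1 := congrFun (hsum n) i
        have h2 := hqB n i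
        have h3 := hy0 n i
        rw [Pi.add_apply] at h1
        dsimp only [B]
        linarith
      · have h1 := congrFun (hsum n) i
        have h2 := hqB n i
        have h3 := hx0 n i
        rw [Pi.add_apply] at h1
        dsimp only [B]
        linarith)
  dsimp only at hL0 hL1 hu hw
  have hlL : Tendsto (fun n => l (φ n)) atTop (𝓝 L) := hlim.fst_nhds
  have hlu : Tendsto (fun n => l (φ n) • (x (φ n)).2) atTop (𝓝 u) := hlim.snd_nhds.fst_nhds
  have hlw : Tendsto (fun n => (1 - l (φ n)) • (y (φ n)).2) atTop (𝓝 w) := hlim.snd_nhds.snd_nhds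
  have hlL' : Tendsto (fun n => 1 - l (φ n)) atTop (𝓝 (1 - L)) := hlL.const_sub 1
  have hp2 : p.2 = u + w := by
    refine tendsto_nhds_unique ((hqlim.snd_nhds).comp hφ.tendsto_atTop) ?_
    exact (hlu.add hlw).congr fun n => (hsum (φ n)).symm
  have hpsum : ∑ i, β i * u i + ∑ i, β i * w i = M := by
    rw [← hpM, hp2, ← Finset.sum_add_distrib]
    exact Finset.sum_congr rfl fun i _ => by simp; ring
  have hleft : 0 < L → ∃ y, (∀ m, y ∈ closure (closures k r f m)) ∧ L • y.2 = u ∧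
      (a : ℝ) * y.1 0 + b * y.1 1 ≤ c := by
    intro hL
    obtain ⟨z, hz, hzm, hzu⟩ := exists_tendsto_of_tendsto_smul hlL hL hφ (fun n => hx (φ n)) hlu
    refine ⟨z, hzm, hzu, ?_⟩
    have hcont : Continuous fun p : Pt × (Fin k → ℝ) => (a : ℝ) * p.1 0 + b * p.1 1 := by fun_prop
    have := le_of_tendsto_of_tendsto' (hlL.mul ((hcont.tendsto z).comp hz)) (hlL.mul_const (c : ℝ))
      (fun n => hxc (φ n))
    exact le_of_mul_le_mul_left this hL
  have hright : 0 < 1 - L → ∃ y, (∀ m, y ∈ closure (closures k r f m)) ∧ (1 - L) • y.2 = w ∧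
      (c : ℝ) + 1 ≤ a * y.1 0 + b * y.1 1 := by
    intro hL
    obtain ⟨z, hz, hzm, hzu⟩ := exists_tendsto_of_tendsto_smul hlL' hL hφ (fun n => hy (φ n)) hlw
    refine ⟨z, hzm, hzu, ?_⟩
    have hcont : Continuous fun p : Pt × (Fin k → ℝ) => (a : ℝ) * p.1 0 + b * p.1 1 := by fun_prop
    have := le_of_tendsto_of_tendsto' (hlL'.mul_const ((c : ℝ) + 1))
      (hlL'.mul ((hcont.tendsto z).comp hz)) (fun n => hyc (φ n))
    exact le_of_mul_le_mul_left this hL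
  have hzero : ∀ v : Fin k → ℝ, (∀ i, 0 ≤ v i) → ∑ i, β i * v i ≤ 0 → v = 0 := by
    intro v hv hs
    have h0 : ∑ i, β i * v i = 0 :=
      le_antisymm hs (Finset.sum_nonneg fun i _ => mul_nonneg (hβ i).le (hv i))
    rw [Finset.sum_eq_zero_iff_of_nonneg fun i _ => mul_nonneg (hβ i).le (hv i)] at h0
    exact funext fun i => (mul_eq_zero.1 (h0 i (Finset.mem_univ i))).resolve_left (hβ i).ne'
  rcases hL0.eq_or_lt with hL | hL
  · obtain ⟨z, hz, hzw, hzc⟩ := hright (by linarith)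
    rw [← hL, sub_zero, one_smul] at hzw
    have hMz := hlow z hz
    rw [hzw] at hMz
    have hu0 := hzero u hu.1 (by linarith)
    have : p = z := relaxP_ext hprel (hcl 0 (hz 0)) (by rw [hp2, hu0, zero_add, hzw])
    rw [← this] at hzc
    linarith
  rcases hL1.eq_or_lt with hL' | hL'
  · obtain ⟨z, hz, hzu, hzc⟩ := hleft hL
    rw [hL', one_smul] at hzu
    have hMz := hlow z hz
    rw [hzu] at hMz
    have hw0 := hzero w hw.1 (by linarith)
    have : p = z := relaxP_ext hprel (hcl 0 (hz 0)) (by rw [hp2, hw0, add_zero, hzu])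
    rw [← this] at hzc
    linarith
  have hLp : 0 < 1 - L := by linarith
  obtain ⟨z, hz, hzu, hzc⟩ := hleft hL
  obtain ⟨z', hz', hzw, hzc'⟩ := hright hLp
  have hpz : L • z + (1 - L) • z' = p := by
    refine relaxP_ext (convex_relaxP (hcl 0 (hz 0)) (hcl 0 (hz' 0)) hL0 hLp.le (by ring)) hprel ?_
    rw [hp2, ← hzu, ← hzw]
    rfl
  have hcombo := sum_mul_combo β L (1 - L) z z'
  rw [hpz, hpM] at hcombo
  have h1 := hlow z hz
  have h2 := hlow z' hz'
  have e1 : ∑ i, β i * z.2 i = M := by nlinarith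
  have e2 : ∑ i, β i * z'.2 i = M := by nlinarith
  have hmem : ∀ z, (∀ m, z ∈ closure (closures k r f m)) → ∑ i, β i * z.2 i = M → z ∈ K' :=
    fun z hz hzM => ⟨mem_iInter.2 fun n => ⟨hz n, hzM.le.trans hMγ⟩, hzM⟩
  have := ((mem_extremePoints.1 hp).2 z (hmem z hz e1) z' (hmem z' hz' e2)
    ⟨L, 1 - L, hL, hLp, by ring, hpz⟩).1
  rw [this] at hzc
  linarith

end Convergence

section Support

variable {k : ℕ} {r : Fin k → Pt} {f : Pt} {α : Fin k → ℝ}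

theorem exists_forall_le_mul {ι : Type} [Fintype ι] (a e : ι → ℝ)
    (h₀ : ∀ i, a i = 0 → e i ≤ 0)
    (h₁ : ∀ i j, 0 < a i → a j < 0 → -a j * e i + a i * e j ≤ 0) : ∃ t : ℝ, ∀ i, e i ≤ a i * t := by
  classical
  by_cases hP : (Finset.univ.filter fun i => 0 < a i).Nonempty
  · obtain ⟨i, hi, hmax⟩ := Finset.exists_max_image _ (fun i => e i / a i) hP
    rw [Finset.mem_filter_univ] at hi
    refine ⟨e i / a i, fun j => ?_⟩
    rcases lt_trichotomy (a j) 0 with hj | hj | hj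
    · have := h₁ i j hi hj
      rw [mul_div_assoc', le_div_iff₀ hi]
      linarith
    · simpa [hj] using h₀ j hj
    · have := hmax j ((Finset.mem_filter_univ _).2 hj)
      rw [div_le_iff₀ hj] at this
      linarith
  · have hle : ∀ i, a i ≤ 0 := fun i => not_lt.1 fun h =>
      hP ⟨i, (Finset.mem_filter_univ _).2 h⟩
    by_cases hN : (Finset.univ.filter fun i => a i < 0).Nonempty
    · obtain ⟨i, hi, hmin⟩ := Finset.exists_min_image _ (fun i => e i / a i) hN
      refine ⟨e i / a i, fun j => ?_⟩
      rcases (hle j).lt_or_eq with hj | hj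
      · have := hmin j ((Finset.mem_filter_univ _).2 hj)
        rw [le_div_iff_of_neg hj] at this
        linarith
      · simpa [hj] using h₀ j hj
    · refine ⟨0, fun j => ?_⟩
      rcases (hle j).lt_or_eq with hj | hj
      · exact absurd ⟨j, (Finset.mem_filter_univ _).2 hj⟩ hN
      · simpa using h₀ j hj

/-- **Farkas' lemma** for systems of linear inequalities in `ℝᵈ`. -/
theorem farkas_exists_le (d : ℕ) : ∀ {ι : Type} [Fintype ι] (A : ι → Fin d → ℝ) (b : ι → ℝ),
    (∀ y : ι → ℝ, (∀ i, 0 ≤ y i) → (∀ j, ∑ i, y i * A i j = 0) → ∑ i, y i * b i ≤ 0) →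
    ∃ x : Fin d → ℝ, ∀ i, b i ≤ ∑ j, A i j * x j := by
  classical
  induction d with
  | zero =>
    intro ι _ A b h
    refine ⟨0, fun i => ?_⟩
    have h0 : (0 : ι → ℝ) ≤ Pi.single i 1 := Pi.single_nonneg.2 zero_le_one
    have := h (Pi.single i 1) h0 (fun j => j.elim0)
    simpa [Pi.single_apply] using this
  | succ d ih =>
    intro ι _ A b h
    let w₁ : ι × ι → ℝ := fun p =>
      if A p.1 0 = 0 then 1 else if 0 < A p.1 0 ∧ A p.2 0 < 0 then -A p.2 0 else 0
    let w₂ : ι × ι → ℝ := fun p =>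
      if A p.1 0 = 0 then 0 else if 0 < A p.1 0 ∧ A p.2 0 < 0 then A p.1 0 else 0
    have hw₁ : ∀ p, 0 ≤ w₁ p := by
      intro p
      dsimp only [w₁]
      split_ifs with h1 h2
      · exact zero_le_one
      · linarith [h2.2]
      · exact le_rfl
    have hw₂ : ∀ p, 0 ≤ w₂ p := by
      intro p
      dsimp only [w₂]
      split_ifs with h1 h2
      · exact le_rfl
      · exact h2.1.le
      · exact le_rfl
    have hw : ∀ p, w₁ p * A p.1 0 + w₂ p * A p.2 0 = 0 := by
      intro p
      dsimp only [w₁, w₂]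
      split_ifs with h1 h2
      · simp [h1]
      · ring
      · ring
    obtain ⟨x, hx⟩ := ih (fun p : ι × ι => fun j => w₁ p * A p.1 j.succ + w₂ p * A p.2 j.succ)
      (fun p => w₁ p * b p.1 + w₂ p * b p.2) (by
        intro y hy hyA
        have key : ∀ c : ι → ℝ, ∑ i, (∑ j, y (i, j) * w₁ (i, j) + ∑ j, y (j, i) * w₂ (j, i)) * c i =
            ∑ p : ι × ι, y p * (w₁ p * c p.1 + w₂ p * c p.2) := by
          intro c
          simp only [add_mul, mul_add, Finset.sum_add_distrib, Finset.sum_mul,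
            Fintype.sum_prod_type]
          congr 1
          · exact Finset.sum_congr rfl fun i _ => Finset.sum_congr rfl fun j _ => by ring
          · rw [Finset.sum_comm]
            exact Finset.sum_congr rfl fun i _ => Finset.sum_congr rfl fun j _ => by ring
        rw [← key]
        refine h _ (fun i => add_nonneg (Finset.sum_nonneg fun j _ => mul_nonneg (hy _) (hw₁ _))
          (Finset.sum_nonneg fun j _ => mul_nonneg (hy _) (hw₂ _))) (fun j => ?_)
        rw [key]
        refine Fin.cases ?_ (fun j => hyA j) j
        exact Finset.sum_eq_zero fun p _ => by rw [hw, mul_zero])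
    obtain ⟨t, ht⟩ := exists_forall_le_mul (fun i => A i 0)
      (fun i => b i - ∑ j : Fin d, A i j.succ * x j) (fun i hi => by
        have := hx (i, i)
        simp only [w₁, w₂, hi, if_true] at this
        simpa using this) (fun i j hi hj => by
        have := hx (i, j)
        simp only [w₁, w₂, hi.ne', if_false, hi, hj, and_self, if_true, add_mul,
          Finset.sum_add_distrib, mul_assoc, ← Finset.mul_sum] at this
        linarith)
    refine ⟨Fin.cons t x, fun i => ?_⟩
    have := ht i
    simp only [Fin.sum_univ_succ, Fin.cons_zero, Fin.cons_succ]
    linarith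

/-- Lattice points that are reached at cost at most one. -/
def Tight (k : ℕ) (r : Fin k → Pt) (f : Pt) (α : Fin k → ℝ) (i j : ℤ) : Prop :=
  ∃ s : Fin k → ℝ, ((![(i : ℝ), j] : Pt), s) ∈ relaxP k r f ∧ ∑ l, α l * s l ≤ 1

theorem isIntPt_vec (i j : ℤ) : IsIntPt ![(i : ℝ), j] := by
  intro l
  fin_cases l
  · exact ⟨i, rfl⟩
  · exact ⟨j, rfl⟩

theorem IsIntPt.exists_eq_vec {x : Pt} (hx : IsIntPt x) : ∃ i j : ℤ, x = ![(i : ℝ), j] := by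
  obtain ⟨i, hi⟩ := hx 0
  obtain ⟨j, hj⟩ := hx 1
  refine ⟨i, j, ?_⟩
  ext l
  fin_cases l
  · exact hi
  · exact hj

theorem relaxP_fst_apply {p : Pt × (Fin k → ℝ)} (hp : p ∈ relaxP k r f) (j : Fin 2) :
    p.1 j = f j + ∑ i, p.2 i * r i j := by
  rw [hp.2]
  simp [Finset.sum_apply]

theorem relaxP_affine {p : Pt × (Fin k → ℝ)} (hp : p ∈ relaxP k r f) (α : Fin k → ℝ) (a b : ℝ) :
    ∑ i, α i * p.2 i + (a * p.1 0 + b * p.1 1) =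
      ∑ i, (α i + a * r i 0 + b * r i 1) * p.2 i + (a * f 0 + b * f 1) := by
  rw [relaxP_fst_apply hp, relaxP_fst_apply hp]
  have : ∑ i, (α i + a * r i 0 + b * r i 1) * p.2 i =
      ∑ i, α i * p.2 i + a * ∑ i, p.2 i * r i 0 + b * ∑ i, p.2 i * r i 1 := by
    rw [Finset.mul_sum, Finset.mul_sum, ← Finset.sum_add_distrib, ← Finset.sum_add_distrib]
    exact Finset.sum_congr rfl fun i _ => by ring
  rw [this]
  ring

theorem exists_support (hα : ∀ i, 0 ≤ α i) (hvalid : ValidIneq k r f α 1) (i j : ℤ) :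
    ∃ a b : ℝ, 1 ≤ a * (f 0 - i) + b * (f 1 - j) ∧ ∀ l, 0 ≤ α l + a * r l 0 + b * r l 1 := by
  obtain ⟨x, hx⟩ := farkas_exists_le 2 (ι := Option (Fin k))
    (fun o => o.elim (fun l => f l - (![(i : ℝ), j] : Pt) l) r) (fun o => o.elim 1 fun l => -α l)
    (by
      intro y hy hyA
      simp only [Fintype.sum_option, Option.elim] at hyA ⊢
      rcases (hy none).eq_or_lt with h0 | h0
      · rw [← h0, zero_mul, zero_add]
        exact Finset.sum_nonpos fun l _ => by
          rw [mul_neg]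
          exact neg_nonpos.2 (mul_nonneg (hy _) (hα l))
      · have hmem : ((![(i : ℝ), j] : Pt), fun l => y (some l) / y none) ∈ mixedP k r f := by
          refine ⟨isIntPt_vec i j, fun l => div_nonneg (hy _) h0.le, ?_⟩
          ext m
          have hm := hyA m
          simp only [Pi.add_apply, Finset.sum_apply, Pi.smul_apply, smul_eq_mul]
          have : ∑ l, y (some l) / y none * r l m = (∑ l, y (some l) * r l m) / y none := by
            rw [Finset.sum_div]
            exact Finset.sum_congr rfl fun l _ => by ring
          rw [this]
          field_simp
          linarith
        have h1 := hvalid _ hmem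
        have h2 : ∑ l, α l * (y (some l) / y none) = (∑ l, α l * y (some l)) / y none := by
          rw [Finset.sum_div]
          exact Finset.sum_congr rfl fun l _ => by ring
        dsimp only at h1
        rw [h2, le_div_iff₀ h0] at h1
        have h3 : ∑ l, y (some l) * -α l = -∑ l, α l * y (some l) := by
          rw [← Finset.sum_neg_distrib]
          exact Finset.sum_congr rfl fun l _ => by ring
        rw [h3]
        linarith)
  refine ⟨x 0, x 1, ?_, fun l => ?_⟩
  · have := hx none
    simp [Fin.sum_univ_two] at this
    linarith
  · have := hx (some l)
    simp [Fin.sum_univ_two] at this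
    linarith

theorem one_le_of_support {a b : ℝ} {i j : ℤ} (h : 1 ≤ a * (f 0 - i) + b * (f 1 - j))
    (h' : ∀ l, 0 ≤ α l + a * r l 0 + b * r l 1) {p : Pt × (Fin k → ℝ)} (hp : p ∈ relaxP k r f) :
    1 ≤ ∑ l, α l * p.2 l + (a * p.1 0 + b * p.1 1 + (-a * i - b * j)) := by
  have h1 := relaxP_affine hp α a b
  have h2 : 0 ≤ ∑ l, (α l + a * r l 0 + b * r l 1) * p.2 l :=
    Finset.sum_nonneg fun l _ => mul_nonneg (h' l) (hp.1 l)
  linarith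

theorem Tight.exists_support (hα : ∀ i, 0 ≤ α i) (hvalid : ValidIneq k r f α 1) (i j : ℤ) :
    ∃ a b : ℝ, 1 ≤ a * (f 0 - i) + b * (f 1 - j) ∧
      (∀ l, 0 ≤ α l + a * r l 0 + b * r l 1) ∧
      FiniteRank k r f α a b (-a * i - b * j) ∧
      ∀ i' j' : ℤ, Tight k r f α i' j' → 0 ≤ a * i' + b * j' + (-a * i - b * j) := by
  obtain ⟨a, b, h, h'⟩ := _root_.exists_support hα hvalid i j
  refine ⟨a, b, h, h', ⟨0, fun p hp => one_le_of_support h h' hp⟩, ?_⟩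
  rintro i' j' ⟨s, hs, hs1⟩
  have := one_le_of_support h h' hs
  simp at this
  linarith

theorem exists_gap (hα : ∀ i, 0 < α i) : ∃ η : ℝ, 0 < η ∧ ∀ (i j : ℤ) (s : Fin k → ℝ),
    ((![(i : ℝ), j] : Pt), s) ∈ relaxP k r f → ¬ Tight k r f α i j → 1 + η ≤ ∑ l, α l * s l := by
  have hcomp := isCompact_relaxP_inter_le (r := r) (f := f) hα 2
  obtain ⟨R, hR⟩ := hcomp.isBounded.exists_norm_le
  have hloc : ∀ i j : ℤ, ∃ η : ℝ, 0 < η ∧ ∀ s : Fin k → ℝ,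
      ((![(i : ℝ), j] : Pt), s) ∈ relaxP k r f → ¬ Tight k r f α i j → 1 + η ≤ ∑ l, α l * s l := by
    intro i j
    by_cases ht : Tight k r f α i j
    · exact ⟨1, one_pos, fun s _ h => absurd ht h⟩
    have hc : IsCompact ((relaxP k r f ∩ {p | ∑ i, α i * p.2 i ≤ 2}) ∩ {p | p.1 = ![(i : ℝ), j]}) :=
      hcomp.inter_right (isClosed_eq continuous_fst continuous_const)
    rcases Set.eq_empty_or_nonempty
      ((relaxP k r f ∩ {p | ∑ i, α i * p.2 i ≤ 2}) ∩ {p | p.1 = ![(i : ℝ), j]}) with he | hn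
    · refine ⟨1, one_pos, fun s hs _ => ?_⟩
      by_contra hlt
      have : ((![(i : ℝ), j] : Pt), s) ∈
          ((relaxP k r f ∩ {p | ∑ i, α i * p.2 i ≤ 2}) ∩ {p | p.1 = ![(i : ℝ), j]}) :=
        ⟨⟨hs, by simp only [mem_ofPred_eq]; linarith⟩, rfl⟩
      rw [he] at this
      exact this
    · obtain ⟨⟨x, s₀⟩, ⟨⟨hp, hp2⟩, hpx⟩, hmin⟩ :=
        hc.exists_isMinOn hn (continuous_sum_mul α).continuousOn
      obtain rfl : x = ![(i : ℝ), j] := hpx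
      have hgt : 1 < ∑ l, α l * s₀ l := not_le.1 fun h => ht ⟨s₀, hp, h⟩
      refine ⟨∑ l, α l * s₀ l - 1, by linarith, fun s hs _ => ?_⟩
      rw [add_sub_cancel]
      by_cases h2 : ∑ l, α l * s l ≤ 2
      · exact hmin (a := (![(i : ℝ), j], s)) ⟨⟨hs, h2⟩, rfl⟩
      · exact le_trans (by exact hp2) (not_le.1 h2).le
  choose e he hes using hloc
  obtain ⟨N, hN⟩ := exists_nat_ge R
  obtain ⟨η, ⟨hη, hη1⟩, hηe⟩ : ∃ η : ℝ, (0 < η ∧ η < 1) ∧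
      ∀ p ∈ Finset.Icc (-(N : ℤ)) N ×ˢ Finset.Icc (-(N : ℤ)) N, η < e p.1 p.2 := by
    have h1 : ∀ᶠ η : ℝ in nhdsWithin 0 (Ioi 0), 0 < η ∧ η < 1 :=
      Ioo_mem_nhdsGT one_pos
    have h2 : ∀ᶠ η : ℝ in nhdsWithin 0 (Ioi 0),
        ∀ p ∈ Finset.Icc (-(N : ℤ)) N ×ˢ Finset.Icc (-(N : ℤ)) N, η < e p.1 p.2 := by
      rw [Filter.eventually_all_finset]
      intro p _
      filter_upwards [Ioo_mem_nhdsGT (he p.1 p.2)] with η hη using hη.2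
    exact (h1.and h2).exists
  refine ⟨η, hη, fun i j s hs ht => ?_⟩
  by_cases h2 : ∑ l, α l * s l ≤ 2
  · have hb := hR _ ⟨hs, h2⟩
    have hb' : ‖(![(i : ℝ), j] : Pt)‖ ≤ N := (norm_fst_le _).trans (hb.trans hN)
    have h0 := (norm_le_pi_norm (![(i : ℝ), j] : Pt) 0).trans hb'
    have h1 := (norm_le_pi_norm (![(i : ℝ), j] : Pt) 1).trans hb'
    simp only [Matrix.cons_val_zero, Matrix.cons_val_one, Real.norm_eq_abs, abs_le] at h0 h1
    have := hηe (i, j) (by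
      simp only [Finset.mem_product, Finset.mem_Icc]
      exact ⟨⟨by exact_mod_cast h0.1, by exact_mod_cast h0.2⟩,
        ⟨by exact_mod_cast h1.1, by exact_mod_cast h1.2⟩⟩)
    have h3 := hes i j s hs ht
    dsimp only at this
    linarith
  · linarith

theorem FiniteRank.exists_ball (hα : ∀ i, 0 < α i) (hvalid : ValidIneq k r f α 1) :
    ∃ δ : ℝ, 0 < δ ∧ ∀ a b c : ℝ, |a| < δ → |b| < δ → |c| < δ →
      (∀ i j : ℤ, Tight k r f α i j → 0 < a * i + b * j + c) → FiniteRank k r f α a b c := by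
  obtain ⟨η, hη, hgap⟩ := exists_gap (r := r) (f := f) hα
  set ε : ℝ := η / (η + 3) with hε
  have hε0 : 0 < ε := by positivity
  have hε1 : ε * (η + 3) = η := div_mul_cancel₀ _ (by positivity)
  have hε2 : ε < 1 := by rw [hε, div_lt_one (by positivity)]; linarith
  have small : ∀ (C e : ℝ), 0 < e → ∀ᶠ δ : ℝ in nhdsWithin 0 (Ioi 0), δ * C < e := by
    intro C e he
    have : Filter.Tendsto (fun δ : ℝ => δ * C) (nhdsWithin 0 (Ioi 0)) (nhds (0 * C)) :=
      (Filter.tendsto_id.mul_const C).mono_left nhdsWithin_le_nhds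
    rw [zero_mul] at this
    exact this.eventually (gt_mem_nhds he)
  obtain ⟨δ, ⟨hδ1, hδ2⟩, hδ⟩ := (((Filter.eventually_all.2 fun i =>
    small (|r i 0| + |r i 1|) (ε * α i) (mul_pos hε0 (hα i))).and
      (small (|f 0| + |f 1| + 1) ε hε0)).and self_mem_nhdsWithin).exists
  have hδ0 : 0 < δ := hδ
  refine ⟨δ, hδ0, fun a b c ha hb hc hT => ?_⟩
  have hlin : ∀ (x : Pt), |a * x 0 + b * x 1| ≤ δ * (|x 0| + |x 1|) := by
    intro x
    refine (abs_add_le _ _).trans ?_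
    rw [abs_mul, abs_mul, mul_add]
    exact add_le_add (mul_le_mul_of_nonneg_right ha.le (abs_nonneg _))
      (mul_le_mul_of_nonneg_right hb.le (abs_nonneg _))
  have hr : ∀ i, -(ε * α i) < a * r i 0 + b * r i 1 := fun i =>
    (abs_lt.1 ((hlin (r i)).trans_lt (hδ1 i))).1
  have hf : -ε < a * f 0 + b * f 1 + c := by
    have h1 := (abs_le.1 (hlin f)).1
    have h2 := (abs_lt.1 hc).1
    linarith
  have hβ : ∀ i, 0 < α i + a * r i 0 + b * r i 1 := by
    intro i
    have h1 := hr i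
    have h2 : ε * α i < 1 * α i := mul_lt_mul_of_pos_right hε2 (hα i)
    linarith
  obtain ⟨n, hn⟩ := exists_closures_le (r := r) (f := f) hβ (γ := 1 - (a * f 0 + b * f 1 + c)) (by
    rintro ⟨x, s⟩ ⟨hx, hp⟩
    obtain ⟨i, j, rfl⟩ := hx.exists_eq_vec
    have haff := relaxP_affine hp α a b
    by_cases ht : Tight k r f α i j
    · have h1 := hT i j ht
      have h2 := hvalid _ ⟨hx, hp⟩
      simp at haff h1 h2 ⊢
      linarith
    · have h1 := hgap i j s hp ht
      have h2 : (1 - ε) * ∑ l, α l * s l ≤ ∑ l, (α l + a * r l 0 + b * r l 1) * s l := by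
        rw [Finset.mul_sum]
        refine Finset.sum_le_sum fun l _ => ?_
        rw [← mul_assoc]
        exact mul_le_mul_of_nonneg_right (by linarith [hr l]) (hp.1 l)
      have h3 : (1 - ε) * (1 + η) ≤ (1 - ε) * ∑ l, α l * s l :=
        mul_le_mul_of_nonneg_left h1 (by linarith)
      dsimp only
      linarith)
  refine ⟨n, fun p hp => ?_⟩
  have h1 := hn p hp
  have h2 := relaxP_affine (closures_subset_relaxP n hp) α a b
  linarith

end Support

section SmallForms

variable {k : ℕ} {r : Fin k → Pt} {f : Pt} {α : Fin k → ℝ}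

theorem tight_finite (hα : ∀ i, 0 < α i) : {z : ℤ × ℤ | Tight k r f α z.1 z.2}.Finite := by
  obtain ⟨R, hR⟩ := (isCompact_relaxP_inter_le (r := r) (f := f) hα 1).isBounded.exists_norm_le
  obtain ⟨N, hN⟩ := exists_nat_ge R
  refine (Set.finite_Icc ((-N, -N) : ℤ × ℤ) (N, N)).subset ?_
  rintro ⟨i, j⟩ ⟨s, hs, hs1⟩
  have hb : ‖(![(i : ℝ), j] : Pt)‖ ≤ N := (norm_fst_le _).trans ((hR _ ⟨hs, hs1⟩).trans hN)
  have h0 := (norm_le_pi_norm (![(i : ℝ), j] : Pt) 0).trans hb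
  have h1 := (norm_le_pi_norm (![(i : ℝ), j] : Pt) 1).trans hb
  simp only [Matrix.cons_val_zero, Matrix.cons_val_one, Real.norm_eq_abs, abs_le] at h0 h1
  exact ⟨⟨by exact_mod_cast h0.1, by exact_mod_cast h1.1⟩,
    ⟨by exact_mod_cast h0.2, by exact_mod_cast h1.2⟩⟩

theorem eventually_pos_add_mul (x y : ℝ) (hx : 0 < x) :
    ∀ᶠ e : ℝ in nhdsWithin 0 (Ioi 0), 0 < x + e * y := by
  have : Filter.Tendsto (fun e : ℝ => x + e * y) (nhdsWithin 0 (Ioi 0)) (nhds (x + 0 * y)) :=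
    ((Filter.tendsto_id.mul_const y).const_add x).mono_left nhdsWithin_le_nhds
  rw [zero_mul, add_zero] at this
  exact this.eventually (lt_mem_nhds hx)

theorem eventually_abs_add_mul_lt (x y δ : ℝ) (hx : |x| < δ) :
    ∀ᶠ e : ℝ in nhdsWithin 0 (Ioi 0), |x + e * y| < δ := by
  have : Filter.Tendsto (fun e : ℝ => |x + e * y|) (nhdsWithin 0 (Ioi 0)) (nhds |x + 0 * y|) :=
    (((Filter.tendsto_id.mul_const y).const_add x).mono_left nhdsWithin_le_nhds).abs
  rw [zero_mul, add_zero] at this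
  exact this.eventually (gt_mem_nhds hx)

theorem Set.Finite.eventually_pos_add_mul {β : Type} {S : Set β} (hS : S.Finite) (v w : β → ℝ)
    (h : ∀ z ∈ S, 0 < v z) : ∀ᶠ e : ℝ in nhdsWithin 0 (Ioi 0), ∀ z ∈ S, 0 < v z + e * w z :=
  (Filter.eventually_all_finite hS).2 fun z hz => _root_.eventually_pos_add_mul _ _ (h z hz)

/-- Every affine form with coefficients smaller than `δ` that is positive on the tight lattice
points can be added to the inequality while keeping finite split rank. -/
def FiniteRankBall (k : ℕ) (r : Fin k → Pt) (f : Pt) (α : Fin k → ℝ) (δ : ℝ) : Prop :=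
  ∀ a b c : ℝ, |a| < δ → |b| < δ → |c| < δ →
    (∀ i j : ℤ, Tight k r f α i j → 0 < a * i + b * j + c) → FiniteRank k r f α a b c

theorem FiniteRankBall.of_split {δ : ℝ} (hball : FiniteRankBall k r f α δ) (hα : ∀ i, 0 < α i)
    {a b c a₁ b₁ c₁ t : ℝ} (p q m : ℤ) (ha : |a| < δ) (hb : |b| < δ) (hc : |c| < δ)
    (hg : FiniteRank k r f α a₁ b₁ c₁) (ht : 0 ≤ t)
    (ha₁ : a = a₁ - t * p) (hb₁ : b = b₁ - t * q) (hc₁ : c = c₁ + t * m)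
    (hV : ∀ i j : ℤ, Tight k r f α i j → 0 ≤ a * i + b * j + c)
    (hV' : ∀ i j : ℤ, Tight k r f α i j → m + 1 ≤ p * i + q * j → 0 < a * i + b * j + c) :
    FiniteRank k r f α a b c := by
  have hfin : {z : ℤ × ℤ | Tight k r f α z.1 z.2 ∧ m + 1 ≤ p * z.1 + q * z.2}.Finite :=
    (tight_finite hα).subset fun z hz => hz.1
  obtain ⟨e, ⟨⟨⟨h1, h2⟩, h3⟩, h4⟩, he⟩ :=
    (((((eventually_abs_add_mul_lt a (-p) δ ha).and (eventually_abs_add_mul_lt b (-q) δ hb)).and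
      (eventually_abs_add_mul_lt c (m + 1) δ hc)).and
      (hfin.eventually_pos_add_mul (fun z => a * z.1 + b * z.2 + c)
        (fun z => (m + 1) - (p * z.1 + q * z.2)) fun z hz => hV' z.1 z.2 hz.1 hz.2)).and
      self_mem_nhdsWithin).exists
  have he0 : 0 < e := he
  refine hg.split (hball _ _ _ h1 h2 h3 fun i j hij => ?_) p q m (fun x y hxy => ?_)
    fun x y hxy => ?_
  · by_cases h : m + 1 ≤ p * i + q * j
    · have := h4 (i, j) ⟨hij, h⟩
      dsimp only at this
      linarith
    · have h5 : p * i + q * j ≤ m := by omega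
      have h6 : (p * i + q * j : ℝ) ≤ m := by exact_mod_cast h5
      have h7 := hV i j hij
      have h8 := mul_le_mul_of_nonneg_left h6 he0.le
      linarith
  · have := mul_le_mul_of_nonneg_left hxy ht
    rw [ha₁, hb₁, hc₁]
    linarith
  · have := mul_le_mul_of_nonneg_left hxy he0.le
    linarith

theorem exists_convex_comb_eq {x y z : ℝ} (h₁ : x < y) (h₂ : y < z) :
    ∃ s t : ℝ, 0 ≤ s ∧ 0 ≤ t ∧ s + t = 1 ∧ s * x + t * z = y := by
  have h : 0 < z - x := by linarith
  refine ⟨(z - y) / (z - x), (y - x) / (z - x), div_nonneg (by linarith) h.le,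
    div_nonneg (by linarith) h.le, ?_, ?_⟩ <;> field_simp <;> ring

theorem FiniteRankBall.of_pos_off_point {δ : ℝ} (hball : FiniteRankBall k r f α δ)
    (hα : ∀ i, 0 < α i) (hvalid : ValidIneq k r f α 1) {a b c : ℝ} (i₀ j₀ : ℤ)
    (ha : |a| < δ) (hb : |b| < δ) (hc : |c| < δ) (h₀ : a * i₀ + b * j₀ + c = 0)
    (hV : ∀ i j : ℤ, Tight k r f α i j → (i, j) ≠ (i₀, j₀) → 0 < a * i + b * j + c) :
    FiniteRank k r f α a b c := by
  obtain ⟨u, v, -, -, hg, -⟩ := Tight.exists_support (fun i => (hα i).le) hvalid i₀ j₀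
  have hfin : {z : ℤ × ℤ | Tight k r f α z.1 z.2 ∧ z ≠ (i₀, j₀)}.Finite :=
    (tight_finite hα).subset fun z hz => hz.1
  obtain ⟨e, ⟨⟨⟨h1, h2⟩, h3⟩, h4⟩, he⟩ :=
    (((((eventually_pos_add_mul (δ - |a|) (-1) (sub_pos.2 ha)).and
      (eventually_pos_add_mul (δ - |b|) (-1) (sub_pos.2 hb))).and
      (eventually_pos_add_mul (δ - |c|) (-(|(i₀ : ℝ)| + |(j₀ : ℝ)|)) (sub_pos.2 hc))).and
      (hfin.eventually_pos_add_mul (fun z => a * z.1 + b * z.2 + c)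
        (fun z => -(|(z.1 : ℝ) - i₀| + |(z.2 : ℝ) - j₀|)) fun z hz => hV z.1 z.2 hz.1 hz.2)).and
      self_mem_nhdsWithin).exists
  have he0 : 0 < e := he
  have hmul : ∀ d x : ℝ, |d| ≤ e → |d * x| ≤ e * |x| := fun d x hd => by
    rw [abs_mul]
    exact mul_le_mul_of_nonneg_right hd (abs_nonneg _)
  have corner : ∀ ρ σ : ℚ, |u - ρ - a| ≤ e → |v - σ - b| ≤ e →
      FiniteRank k r f α (u - ρ) (v - σ) (-(u - ρ) * i₀ - (v - σ) * j₀) := by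
    intro ρ σ hρ hσ
    have hρ' : (0 : ℝ) < ρ.den := by exact_mod_cast ρ.pos
    have hσ' : (0 : ℝ) < σ.den := by exact_mod_cast σ.pos
    have hρn : (ρ.num : ℝ) = ρ * ρ.den := by exact_mod_cast (Rat.mul_den_eq_num ρ).symm
    have hσn : (σ.num : ℝ) = σ * σ.den := by exact_mod_cast (Rat.mul_den_eq_num σ).symm
    have hpos : ∀ i j : ℤ, Tight k r f α i j → (i, j) ≠ (i₀, j₀) →
        0 < (u - ρ) * i + (v - σ) * j + (-(u - ρ) * i₀ - (v - σ) * j₀) := by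
      intro i j hij hne
      have h5 := h4 (i, j) ⟨hij, hne⟩
      have h6 := (abs_le.1 (hmul _ ((i : ℝ) - i₀) hρ)).1
      have h7 := (abs_le.1 (hmul _ ((j : ℝ) - j₀) hσ)).1
      dsimp only at h5
      linarith
    refine hball.of_split hα (t := 1 / (ρ.den * σ.den)) (ρ.num * σ.den) (σ.num * ρ.den)
      (ρ.num * σ.den * i₀ + σ.num * ρ.den * j₀) ?_ ?_ ?_ hg (by positivity) ?_ ?_ ?_
      (fun i j hij => ?_) fun i j hij hlt => hpos i j hij ?_
    · have := abs_add_le a (u - ρ - a)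
      rw [add_sub_cancel] at this
      linarith
    · have := abs_add_le b (v - σ - b)
      rw [add_sub_cancel] at this
      linarith
    · have h5 := hmul _ (i₀ : ℝ) hρ
      have h6 := hmul _ (j₀ : ℝ) hσ
      have h7 := abs_sub (c - (u - ρ - a) * i₀) ((v - σ - b) * j₀)
      have h8 := abs_sub c ((u - ρ - a) * i₀)
      have h9 : c - (u - ρ - a) * i₀ - (v - σ - b) * j₀ = -(u - ρ) * i₀ - (v - σ) * j₀ := by
        linarith
      rw [h9] at h7
      linarith
    · push_cast
      rw [hρn]
      field_simp
    · push_cast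
      rw [hσn]
      field_simp
    · push_cast
      rw [hρn, hσn]
      field_simp
      ring
    · by_cases hne : (i, j) = (i₀, j₀)
      · obtain ⟨rfl, rfl⟩ := Prod.mk.inj hne
        exact le_of_eq (by ring)
      · exact (hpos i j hij hne).le
    · intro hne
      obtain ⟨rfl, rfl⟩ := Prod.mk.inj hne
      omega
  obtain ⟨ρ₁, hρ₁, hρ₁'⟩ := exists_rat_btwn (show u - a < u - a + e by linarith)
  obtain ⟨ρ₂, hρ₂, hρ₂'⟩ := exists_rat_btwn (show u - a - e < u - a by linarith)
  obtain ⟨σ₁, hσ₁, hσ₁'⟩ := exists_rat_btwn (show v - b < v - b + e by linarith)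
  obtain ⟨σ₂, hσ₂, hσ₂'⟩ := exists_rat_btwn (show v - b - e < v - b by linarith)
  have dρ₁ : |u - ρ₁ - a| ≤ e := abs_le.2 ⟨by linarith, by linarith⟩
  have dρ₂ : |u - ρ₂ - a| ≤ e := abs_le.2 ⟨by linarith, by linarith⟩
  have dσ₁ : |v - σ₁ - b| ≤ e := abs_le.2 ⟨by linarith, by linarith⟩
  have dσ₂ : |v - σ₂ - b| ≤ e := abs_le.2 ⟨by linarith, by linarith⟩
  obtain ⟨s, t, hs, ht, hst, hρ⟩ := exists_convex_comb_eq
    (show u - ρ₁ < a by linarith) (show a < u - ρ₂ by linarith)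
  obtain ⟨s', t', hs', ht', hst', hσ⟩ := exists_convex_comb_eq
    (show v - σ₁ < b by linarith) (show b < v - σ₂ by linarith)
  have key := ((corner ρ₁ σ₁ dρ₁ dσ₁).convex_comb (corner ρ₂ σ₁ dρ₂ dσ₁) hs ht hst).convex_comb
    ((corner ρ₁ σ₂ dρ₁ dσ₂).convex_comb (corner ρ₂ σ₂ dρ₂ dσ₂) hs ht hst) hs' ht' hst'
  have e1 : s' * (s * (u - ρ₁) + t * (u - ρ₂)) + t' * (s * (u - ρ₁) + t * (u - ρ₂)) = a := by
    rw [hρ, ← add_mul, hst', one_mul]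
  have e2 : s' * (s * (v - σ₁) + t * (v - σ₁)) + t' * (s * (v - σ₂) + t * (v - σ₂)) = b := by
    rw [← add_mul, ← add_mul, hst, one_mul, one_mul, hσ]
  have e3 : s' * (s * (-(u - ρ₁) * i₀ - (v - σ₁) * j₀) + t * (-(u - ρ₂) * i₀ - (v - σ₁) * j₀)) +
      t' * (s * (-(u - ρ₁) * i₀ - (v - σ₂) * j₀) + t * (-(u - ρ₂) * i₀ - (v - σ₂) * j₀)) = c := by
    linear_combination (-(i₀ : ℝ)) * e1 - j₀ * e2 - h₀
  rwa [e1, e2, e3] at key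

theorem Tight.of_barycentric {a₀ a₁ b₀ b₁ c₀ c₁ w₀ w₁ : ℤ} (ha : Tight k r f α a₀ a₁)
    (hb : Tight k r f α b₀ b₁) (hc : Tight k r f α c₀ c₁) {x y z : ℤ} (hx : 0 ≤ x) (hy : 0 ≤ y)
    (hz : 0 ≤ z) (hn : 0 < x + y + z) (h₀ : (x + y + z) * w₀ = x * a₀ + y * b₀ + z * c₀)
    (h₁ : (x + y + z) * w₁ = x * a₁ + y * b₁ + z * c₁) : Tight k r f α w₀ w₁ := by
  obtain ⟨s, ⟨hs, hse⟩, hs1⟩ := ha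
  obtain ⟨s', ⟨hs', hse'⟩, hs1'⟩ := hb
  obtain ⟨s'', ⟨hs'', hse''⟩, hs1''⟩ := hc
  have hn' : (0 : ℝ) < x + y + z := by exact_mod_cast hn
  have hx' : (0 : ℝ) ≤ x := by exact_mod_cast hx
  have hy' : (0 : ℝ) ≤ y := by exact_mod_cast hy
  have hz' : (0 : ℝ) ≤ z := by exact_mod_cast hz
  have h₀' : ((x : ℝ) + y + z) * w₀ = x * a₀ + y * b₀ + z * c₀ := by exact_mod_cast h₀
  have h₁' : ((x : ℝ) + y + z) * w₁ = x * a₁ + y * b₁ + z * c₁ := by exact_mod_cast h₁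
  have hsum : ∀ β : Fin k → ℝ, ∑ l, β l * ((x * s l + y * s' l + z * s'' l) / (x + y + z)) =
      (x * ∑ l, β l * s l + y * ∑ l, β l * s' l + z * ∑ l, β l * s'' l) / (x + y + z) := by
    intro β
    rw [Finset.mul_sum, Finset.mul_sum, Finset.mul_sum, ← Finset.sum_add_distrib,
      ← Finset.sum_add_distrib, Finset.sum_div]
    exact Finset.sum_congr rfl fun l _ => by ring
  have hcoord : ∀ {i j : ℤ} {s : Fin k → ℝ},
      (![(i : ℝ), j] : Pt) = f + ∑ l, s l • r l → ∀ m, (![(i : ℝ), j] : Pt) m =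
        f m + ∑ l, r l m * s l := by
    intro i j s h m
    rw [h]
    simp [Finset.sum_apply, mul_comm]
  refine ⟨fun l => (x * s l + y * s' l + z * s'' l) / (x + y + z), ⟨fun l => ?_, ?_⟩, ?_⟩
  · exact div_nonneg (add_nonneg (add_nonneg (mul_nonneg hx' (hs l)) (mul_nonneg hy' (hs' l)))
      (mul_nonneg hz' (hs'' l))) hn'.le
  · ext m
    have := hsum fun l => r l m
    simp only [Pi.add_apply, Finset.sum_apply, Pi.smul_apply, smul_eq_mul]
    rw [Finset.sum_congr rfl fun l _ => mul_comm _ (r l m), this]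
    have e1 := hcoord hse m
    have e2 := hcoord hse' m
    have e3 := hcoord hse'' m
    have e4 : ((x : ℝ) + y + z) * (![(w₀ : ℝ), w₁] : Pt) m = x * (![(a₀ : ℝ), a₁] : Pt) m +
        y * (![(b₀ : ℝ), b₁] : Pt) m + z * (![(c₀ : ℝ), c₁] : Pt) m := by
      fin_cases m
      · exact h₀'
      · exact h₁'
    rw [e1, e2, e3] at e4
    dsimp only at e4
    rw [← sub_eq_iff_eq_add', eq_div_iff hn'.ne']
    linarith
  · rw [hsum, div_le_one hn']
    have e1 := mul_le_mul_of_nonneg_left hs1 hx'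
    have e2 := mul_le_mul_of_nonneg_left hs1' hy'
    have e3 := mul_le_mul_of_nonneg_left hs1'' hz'
    linarith

end SmallForms

section Strip

variable {k : ℕ} {r : Fin k → Pt} {f : Pt} {α : Fin k → ℝ}

/-- The integers whose image under an affine map is tight form an interval, so they are covered by
two consecutive integers unless they contain three consecutive ones. -/
theorem Tight.exists_three_or_subset_pair (x₀ x₁ y₀ y₁ : ℤ) :
    (∃ n : ℤ, Tight k r f α (x₀ + (n - 1) * y₀) (x₁ + (n - 1) * y₁) ∧
      Tight k r f α (x₀ + n * y₀) (x₁ + n * y₁) ∧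
      Tight k r f α (x₀ + (n + 1) * y₀) (x₁ + (n + 1) * y₁)) ∨
    ∃ n : ℤ, ∀ x : ℤ, Tight k r f α (x₀ + x * y₀) (x₁ + x * y₁) → x = n ∨ x = n + 1 := by
  have hconv : ∀ x y z : ℤ, x < y → y < z → Tight k r f α (x₀ + x * y₀) (x₁ + x * y₁) →
      Tight k r f α (x₀ + z * y₀) (x₁ + z * y₁) → Tight k r f α (x₀ + y * y₀) (x₁ + y * y₁) :=
    fun x y z hxy hyz hx hz => hx.of_barycentric hz hz (x := z - y) (y := y - x) (z := 0)
      (by omega) (by omega) le_rfl (by omega) (by ring) (by ring)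
  by_contra! h
  obtain ⟨h₃, h₂⟩ := h
  obtain ⟨n, hn, -⟩ := h₂ 0
  have hup : ∀ n : ℤ, Tight k r f α (x₀ + n * y₀) (x₁ + n * y₁) →
      Tight k r f α (x₀ + (n + 1) * y₀) (x₁ + (n + 1) * y₁) → False := by
    intro n hn hn'
    obtain ⟨x, hx, hx1, hx2⟩ := h₂ n
    rcases lt_or_gt_of_ne hx1 with hlt | hlt
    · refine h₃ n ?_ hn hn'
      rcases (show x ≤ n - 1 by omega).eq_or_lt with rfl | h1
      · exact hx
      · exact hconv x (n - 1) n h1 (by omega) hx hn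
    · refine h₃ (n + 1) ?_ hn' ?_
      · rwa [add_sub_cancel_right]
      · rcases (show n + 1 + 1 ≤ x by omega).eq_or_lt with rfl | h1
        · exact hx
        · exact hconv n (n + 1 + 1) x (by omega) h1 hn hx
  obtain ⟨x, hx, hx1, hx2⟩ := h₂ n
  rcases lt_or_gt_of_ne hx1 with hlt | hlt
  · refine hup (n - 1) ?_ (by rwa [sub_add_cancel])
    rcases (show x ≤ n - 1 by omega).eq_or_lt with rfl | h1
    · exact hx
    · exact hconv x (n - 1) n h1 (by omega) hx hn
  · refine hup n hn ?_
    rcases (show n + 1 ≤ x by omega).eq_or_lt with rfl | h1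
    · exact hx
    · exact hconv n (n + 1) x (by omega) h1 hn hx

theorem eventually_abs_mul_lt (y : ℝ) {δ : ℝ} (hδ : 0 < δ) :
    ∀ᶠ e : ℝ in nhdsWithin 0 (Ioi 0), |e * y| < δ := by
  simpa using eventually_abs_add_mul_lt 0 y δ (by simpa using hδ)

theorem FiniteRankBall.of_three_collinear {δ : ℝ} (hball : FiniteRankBall k r f α δ)
    (hδ : 0 < δ) (hα : ∀ i, 0 < α i) (hvalid : ValidIneq k r f α 1) {p q p' q' m i₀ j₀ : ℤ}
    (hdet : p * q' - q * p' = 1) (hT : ∀ i j : ℤ, Tight k r f α i j → m ≤ p * i + q * j)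
    (hm : p * i₀ + q * j₀ = m) (h₁ : Tight k r f α (i₀ - q) (j₀ + p))
    (h₂ : Tight k r f α (i₀ + q) (j₀ - p)) :
    ∀ᶠ c : ℝ in nhdsWithin 0 (Ioi 0), FiniteRank k r f α (c * p) (c * q) (c * -m) := by
  obtain ⟨u, v, h1f, -, hg, hgT⟩ := Tight.exists_support (fun i => (hα i).le) hvalid i₀ j₀
  have hdet' : (p : ℝ) * q' - q * p' = 1 := by exact_mod_cast hdet
  have hm' : (p : ℝ) * i₀ + q * j₀ = m := by exact_mod_cast hm
  have hflat : v * p - u * q = 0 := by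
    have e1 := hgT _ _ h₁
    have e2 := hgT _ _ h₂
    push_cast at e1 e2
    linarith
  set κ : ℝ := u * q' - v * p' with hκ
  have hu : u = κ * p := by linear_combination p' * hflat - u * hdet'
  have hv : v = κ * q := by linear_combination q' * hflat - v * hdet'
  have hκ0 : κ ≠ 0 := by
    intro h0
    rw [hu, hv, h0] at h1f
    linarith
  have hTm : ∀ {c : ℝ}, 0 < c → ∀ i j : ℤ, Tight k r f α i j →
      0 ≤ c * p * i + c * q * j + c * -m := by
    intro c hc i j hij
    have h3 : (m : ℝ) ≤ p * i + q * j := by exact_mod_cast hT i j hij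
    have h4 := mul_le_mul_of_nonneg_left h3 hc.le
    linarith
  rcases hκ0.lt_or_gt with hneg | hpos
  · filter_upwards [eventually_abs_mul_lt p hδ, eventually_abs_mul_lt q hδ,
      eventually_abs_mul_lt (-m) hδ, self_mem_nhdsWithin] with c h3 h4 h5 hc
    have hc0 : 0 < c := hc
    refine hball.of_split hα (t := c - κ) (-p) (-q) (-m) h3 h4 h5 hg (by linarith) ?_ ?_ ?_
      (hTm hc0) fun i j hij hlt => ?_
    · push_cast
      linear_combination -hu
    · push_cast
      linear_combination -hv
    · push_cast
      linear_combination i₀ * hu + j₀ * hv + κ * hm'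
    · linarith [hT i j hij]
  · filter_upwards [eventually_abs_mul_lt p hδ, eventually_abs_mul_lt q hδ,
      eventually_abs_mul_lt (-m) hδ, Ioo_mem_nhdsGT hpos] with c h3 h4 h5 hc
    refine hball.of_split hα (t := κ - c) p q m h3 h4 h5 hg (by linarith [hc.2]) ?_ ?_ ?_
      (hTm hc.1) fun i j hij hlt => ?_
    · linear_combination -hu
    · linear_combination -hv
    · linear_combination i₀ * hu + j₀ * hv + κ * hm'
    · have e2 : (m : ℝ) + 1 ≤ p * i + q * j := by exact_mod_cast hlt
      have e3 := mul_le_mul_of_nonneg_left e2 hc.1.le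
      linarith [hc.1]

theorem FiniteRankBall.of_subset_pair {δ : ℝ} (hball : FiniteRankBall k r f α δ)
    (hα : ∀ i, 0 < α i) (hvalid : ValidIneq k r f α 1) {p q p' q' m n : ℤ}
    (hdet : p * q' - q * p' = 1) (hT : ∀ i j : ℤ, Tight k r f α i j → m ≤ p * i + q * j)
    (hn : ∀ i j : ℤ, Tight k r f α i j → p * i + q * j = m →
      p' * i + q' * j = n ∨ p' * i + q' * j = n + 1) {c : ℝ} (hc : 0 < c)
    (hcp : |c * p| < δ) (hcq : |c * q| < δ) (hcm : |c * -m| < δ) :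
    FiniteRank k r f α (c * p) (c * q) (c * -m) := by
  have hdet' : (p : ℝ) * q' - q * p' = 1 := by exact_mod_cast hdet
  have hfin : {z : ℤ × ℤ | Tight k r f α z.1 z.2 ∧ p * z.1 + q * z.2 ≠ m}.Finite :=
    (tight_finite hα).subset fun z hz => hz.1
  have hpos : ∀ z ∈ {z : ℤ × ℤ | Tight k r f α z.1 z.2 ∧ p * z.1 + q * z.2 ≠ m},
      0 < c * p * z.1 + c * q * z.2 + c * -m := by
    intro z hz
    have h1 : m + 1 ≤ p * z.1 + q * z.2 := by
      have := hT _ _ hz.1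
      have := hz.2
      omega
    have h2 : (m : ℝ) + 1 ≤ p * z.1 + q * z.2 := by exact_mod_cast h1
    have h3 := mul_le_mul_of_nonneg_left h2 hc.le
    linarith
  obtain ⟨e, ⟨⟨⟨h1, h2⟩, h3, h4⟩, ⟨h5, h6⟩, h7, h8⟩, he⟩ :=
    (((((eventually_abs_add_mul_lt _ p' δ hcp).and (eventually_abs_add_mul_lt _ q' δ hcq)).and
      ((eventually_abs_add_mul_lt _ (-n) δ hcm).and
        (hfin.eventually_pos_add_mul _ (fun z => p' * z.1 + q' * z.2 - n) hpos))).and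
      (((eventually_abs_add_mul_lt _ (-p') δ hcp).and
        (eventually_abs_add_mul_lt _ (-q') δ hcq)).and
      ((eventually_abs_add_mul_lt _ (n + 1) δ hcm).and
        (hfin.eventually_pos_add_mul _ (fun z => n + 1 - (p' * z.1 + q' * z.2)) hpos)))).and
      self_mem_nhdsWithin).exists
  have he0 : 0 < e := he
  have hsolve : ∀ {i j x : ℤ}, p * i + q * j = m → p' * i + q' * j = x →
      (i, j) = (m * q' - x * q, x * p - m * p') := by
    intro i j x e1 e2
    refine Prod.ext ?_ ?_
    · dsimp only
      linear_combination q' * e1 - q * e2 - i * hdet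
    · dsimp only
      linear_combination p * e2 - p' * e1 - j * hdet
  refine (hball.of_pos_off_point hα hvalid (m * q' - n * q) (n * p - m * p') h1 h2 h3 ?_
    fun i j hij hne => ?_).split (hball.of_pos_off_point hα hvalid (m * q' - (n + 1) * q)
      ((n + 1) * p - m * p') h5 h6 h7 ?_ fun i j hij hne => ?_) p' q' n (fun x y hxy => ?_)
      fun x y hxy => ?_
  · push_cast
    linear_combination (c * m + e * n) * hdet'
  · by_cases h : p * i + q * j = m
    · rcases hn i j hij h with h9 | h9
      · exact absurd (hsolve h h9) hne
      · have e1 : (p : ℝ) * i + q * j = m := by exact_mod_cast h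
        have e2 : (p' : ℝ) * i + q' * j = n + 1 := by exact_mod_cast h9
        have e3 : (c * p + e * p') * i + (c * q + e * q') * j + (c * -m + e * -n) = e := by
          linear_combination c * e1 + e * e2
        rwa [e3]
    · have := h4 (i, j) ⟨hij, h⟩
      dsimp only at this
      linarith
  · push_cast
    linear_combination (c * m - e * (n + 1)) * hdet'
  · by_cases h : p * i + q * j = m
    · rcases hn i j hij h with h9 | h9
      · have e1 : (p : ℝ) * i + q * j = m := by exact_mod_cast h
        have e2 : (p' : ℝ) * i + q' * j = n := by exact_mod_cast h9
        have e3 : (c * p + e * -p') * i + (c * q + e * -q') * j + (c * -m + e * (n + 1)) = e := by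
          linear_combination c * e1 - e * e2
        rwa [e3]
      · exact absurd (hsolve h h9) hne
    · have := h8 (i, j) ⟨hij, h⟩
      dsimp only at this
      linarith
  · have := mul_le_mul_of_nonneg_left hxy he0.le
    linarith
  · have := mul_le_mul_of_nonneg_left hxy he0.le
    linarith

theorem FiniteRankBall.eventually_of_halfplane {δ : ℝ} (hball : FiniteRankBall k r f α δ)
    (hδ : 0 < δ) (hα : ∀ i, 0 < α i) (hvalid : ValidIneq k r f α 1) {p q p' q' m : ℤ}
    (hdet : p * q' - q * p' = 1) (hT : ∀ i j : ℤ, Tight k r f α i j → m ≤ p * i + q * j) :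
    ∀ᶠ c : ℝ in nhdsWithin 0 (Ioi 0), FiniteRank k r f α (c * p) (c * q) (c * -m) := by
  rcases Tight.exists_three_or_subset_pair (k := k) (r := r) (f := f) (α := α)
    (m * q') (-m * p') (-q) p with ⟨n, h₁, -, h₂⟩ | ⟨n, hn⟩
  · refine hball.of_three_collinear hδ hα hvalid (i₀ := m * q' - n * q) (j₀ := n * p - m * p')
      hdet hT (by linear_combination m * hdet) ?_ ?_
    · convert h₂ using 1 <;> ring
    · convert h₁ using 1 <;> ring
  · filter_upwards [eventually_abs_mul_lt p hδ, eventually_abs_mul_lt q hδ,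
      eventually_abs_mul_lt (-m) hδ, self_mem_nhdsWithin] with c h3 h4 h5 hc
    refine hball.of_subset_pair hα hvalid hdet hT (n := n) (fun i j hij h => ?_) hc h3 h4 h5
    apply hn
    convert hij using 1
    · linear_combination (-q') * h + i * hdet
    · linear_combination p' * h + j * hdet

/-- If the tight lattice points lie in a split of the plane, the split rank is finite. -/
theorem finiteRank_of_tight_subset_strip (hα : ∀ i, 0 < α i) (hvalid : ValidIneq k r f α 1)
    {p q p' q' m : ℤ} (hdet : p * q' - q * p' = 1)
    (hT : ∀ i j : ℤ, Tight k r f α i j → m ≤ p * i + q * j ∧ p * i + q * j ≤ m + 1) :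
    FiniteRank k r f α 0 0 0 := by
  obtain ⟨δ, hδ, hball⟩ := FiniteRank.exists_ball (r := r) (f := f) hα hvalid
  have hball' : FiniteRankBall k r f α δ := hball
  obtain ⟨c, ⟨h₁, h₂⟩, hc⟩ := (((hball'.eventually_of_halfplane hδ hα hvalid hdet
    fun i j hij => (hT i j hij).1).and (hball'.eventually_of_halfplane hδ hα hvalid
    (p := -p) (q := -q) (p' := -p') (q' := -q') (m := -(m + 1)) (by linear_combination hdet)
    fun i j hij => by linarith [(hT i j hij).2])).and self_mem_nhdsWithin).exists
  have hc0 : 0 < c := hc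
  refine h₁.split h₂ p q m (fun x y hxy => ?_) fun x y hxy => ?_
  · have := mul_le_mul_of_nonneg_left hxy hc0.le
    linarith
  · have := mul_le_mul_of_nonneg_left hxy hc0.le
    push_cast
    linarith

end Strip

section Combinatorics

/-- A convex set of lattice points, given by its membership predicate, none of whose points is an
interior point of the convex hull. -/
structure LatticeFreeConvex (T : ℤ → ℤ → Prop) : Prop where
  convex : ∀ {a₀ a₁ b₀ b₁ c₀ c₁ w₀ w₁ : ℤ}, T a₀ a₁ → T b₀ b₁ → T c₀ c₁ → ∀ x y z : ℤ,
    0 ≤ x → 0 ≤ y → 0 ≤ z → 0 < x + y + z → (x + y + z) * w₀ = x * a₀ + y * b₀ + z * c₀ →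
    (x + y + z) * w₁ = x * a₁ + y * b₁ + z * c₁ → T w₀ w₁
  support : ∀ {i j : ℤ}, T i j → ∃ u v : ℝ, (u ≠ 0 ∨ v ≠ 0) ∧
    ∀ i' j' : ℤ, T i' j' → 0 ≤ u * (i' - i) + v * (j' - j)

/-- The lattice points lie in the closed strip of a split. -/
def InStrip (T : ℤ → ℤ → Prop) : Prop :=
  ∃ p q p' q' m : ℤ, p * q' - q * p' = 1 ∧
    ∀ i j : ℤ, T i j → m ≤ p * i + q * j ∧ p * i + q * j ≤ m + 1

/-- The lattice points contain a unimodular image of the triangle with vertices `(0, 0)`,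
`(2, 0)` and `(0, 2)`. -/
def HasDoubleTriangle (T : ℤ → ℤ → Prop) : Prop :=
  ∃ a₀ a₁ u₀ u₁ v₀ v₁ : ℤ, u₀ * v₁ - u₁ * v₀ = 1 ∧ T a₀ a₁ ∧ T (a₀ + 2 * u₀) (a₁ + 2 * u₁) ∧
    T (a₀ + 2 * v₀) (a₁ + 2 * v₁)

/-- Change of coordinates: the new origin is `o` and the new basis is `e`, `d`. -/
def latticePullback (T : ℤ → ℤ → Prop) (o₀ o₁ e₀ e₁ d₀ d₁ : ℤ) : ℤ → ℤ → Prop :=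
  fun i j => T (o₀ + i * e₀ + j * d₀) (o₁ + i * e₁ + j * d₁)

variable {T : ℤ → ℤ → Prop}

theorem LatticeFreeConvex.pullback (hT : LatticeFreeConvex T) (o₀ o₁ : ℤ) {e₀ e₁ d₀ d₁ : ℤ}
    (hdet : e₀ * d₁ - e₁ * d₀ = 1) : LatticeFreeConvex (latticePullback T o₀ o₁ e₀ e₁ d₀ d₁) where
  convex ha hb hc x y z hx hy hz hn h₀ h₁ :=
    hT.convex ha hb hc x y z hx hy hz hn (by linear_combination e₀ * h₀ + d₀ * h₁)
      (by linear_combination e₁ * h₀ + d₁ * h₁)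
  support {i j} hij := by
    obtain ⟨u, v, hne, h⟩ := hT.support hij
    have hdet' : (e₀ : ℝ) * d₁ - e₁ * d₀ = 1 := by exact_mod_cast hdet
    refine ⟨u * e₀ + v * e₁, u * d₀ + v * d₁, ?_, fun i' j' hij' => ?_⟩
    · by_contra! hzero
      obtain ⟨h1, h2⟩ := hzero
      have hu : u = 0 := by linear_combination d₁ * h1 - e₁ * h2 - u * hdet'
      have hv : v = 0 := by linear_combination e₀ * h2 - d₀ * h1 - v * hdet'
      simp [hu, hv] at hne
    · have := h _ _ hij'
      push_cast at this
      linarith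

theorem latticePullback_of_solve {o₀ o₁ e₀ e₁ d₀ d₁ : ℤ} (hdet : e₀ * d₁ - e₁ * d₀ = 1) {i j : ℤ}
    (h : T i j) : latticePullback T o₀ o₁ e₀ e₁ d₀ d₁ (d₁ * (i - o₀) - d₀ * (j - o₁))
      (e₀ * (j - o₁) - e₁ * (i - o₀)) := by
  unfold latticePullback
  convert h using 1
  · linear_combination (i - o₀) * hdet
  · linear_combination (j - o₁) * hdet

theorem InStrip.of_pullback {o₀ o₁ e₀ e₁ d₀ d₁ : ℤ} (hdet : e₀ * d₁ - e₁ * d₀ = 1)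
    (h : InStrip (latticePullback T o₀ o₁ e₀ e₁ d₀ d₁)) : InStrip T := by
  obtain ⟨p, q, p', q', m, hpq, h⟩ := h
  refine ⟨p * d₁ - q * e₁, q * e₀ - p * d₀, p' * d₁ - q' * e₁, q' * e₀ - p' * d₀,
    m + (p * d₁ - q * e₁) * o₀ + (q * e₀ - p * d₀) * o₁,
    by linear_combination (e₀ * d₁ - e₁ * d₀) * hpq + hdet, fun i j hij => ?_⟩
  have := h _ _ (latticePullback_of_solve (o₀ := o₀) (o₁ := o₁) hdet hij)
  constructor
  · linarith [this.1]
  · linarith [this.2]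

theorem HasDoubleTriangle.of_pullback {o₀ o₁ e₀ e₁ d₀ d₁ : ℤ}
    (hdet : e₀ * d₁ - e₁ * d₀ = 1)
    (h : HasDoubleTriangle (latticePullback T o₀ o₁ e₀ e₁ d₀ d₁)) : HasDoubleTriangle T := by
  obtain ⟨a₀, a₁, u₀, u₁, v₀, v₁, huv, ha, hu, hv⟩ := h
  refine ⟨o₀ + a₀ * e₀ + a₁ * d₀, o₁ + a₀ * e₁ + a₁ * d₁, u₀ * e₀ + u₁ * d₀, u₀ * e₁ + u₁ * d₁,
    v₀ * e₀ + v₁ * d₀, v₀ * e₁ + v₁ * d₁,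
    by linear_combination (e₀ * d₁ - e₁ * d₀) * huv + hdet, ha, ?_, ?_⟩
  · unfold latticePullback at hu
    convert hu using 1 <;> ring
  · unfold latticePullback at hv
    convert hv using 1 <;> ring

theorem inStrip_or_of_pullback {o₀ o₁ e₀ e₁ d₀ d₁ : ℤ} (hdet : e₀ * d₁ - e₁ * d₀ = 1)
    (h : InStrip (latticePullback T o₀ o₁ e₀ e₁ d₀ d₁) ∨
      HasDoubleTriangle (latticePullback T o₀ o₁ e₀ e₁ d₀ d₁)) : InStrip T ∨ HasDoubleTriangle T :=
  h.imp (InStrip.of_pullback hdet) (HasDoubleTriangle.of_pullback hdet)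

theorem exists_primitive_basis {a b : ℤ} (h : a ≠ 0 ∨ b ≠ 0) : ∃ g e₀ e₁ d₀ d₁ : ℤ,
    0 < g ∧ a = g * e₀ ∧ b = g * e₁ ∧ e₀ * d₁ - e₁ * d₀ = 1 := by
  have hg : 0 < (Int.gcd a b : ℤ) := by
    have : 0 < Int.gcd a b := Int.gcd_pos_iff.2 h
    exact_mod_cast this
  obtain ⟨e₀, h₀⟩ := Int.gcd_dvd_left a b
  obtain ⟨e₁, h₁⟩ := Int.gcd_dvd_right a b
  refine ⟨Int.gcd a b, e₀, e₁, -Int.gcdB a b, Int.gcdA a b, hg, h₀, h₁, ?_⟩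
  have := Int.gcd_eq_gcd_ab a b
  refine mul_left_cancel₀ hg.ne' ?_
  linear_combination (-Int.gcdA a b) * h₀ - Int.gcdB a b * h₁ - this

theorem LatticeFreeConvex.not_interior (hT : LatticeFreeConvex T) {a₀ a₁ b₀ b₁ c₀ c₁ : ℤ}
    (w₀ w₁ : ℤ) (ha : T a₀ a₁) (hb : T b₀ b₁) (hc : T c₀ c₁) (x y z : ℤ) (hx : 0 < x) (hy : 0 < y)
    (hz : 0 < z) (h₀ : (x + y + z) * w₀ = x * a₀ + y * b₀ + z * c₀)
    (h₁ : (x + y + z) * w₁ = x * a₁ + y * b₁ + z * c₁)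
    (hdet : (a₀ - w₀) * (b₁ - w₁) - (a₁ - w₁) * (b₀ - w₀) ≠ 0) : False := by
  obtain ⟨u, v, hne, h⟩ := hT.support
    (hT.convex ha hb hc x y z hx.le hy.le hz.le (by omega) h₀ h₁)
  have ea := h _ _ ha
  have eb := h _ _ hb
  have ec := h _ _ hc
  have hx' : (0 : ℝ) < x := by exact_mod_cast hx
  have hy' : (0 : ℝ) < y := by exact_mod_cast hy
  have hz' : (0 : ℝ) < z := by exact_mod_cast hz
  have h₀' : ((x : ℝ) + y + z) * w₀ = x * a₀ + y * b₀ + z * c₀ := by exact_mod_cast h₀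
  have h₁' : ((x : ℝ) + y + z) * w₁ = x * a₁ + y * b₁ + z * c₁ := by exact_mod_cast h₁
  have hdet' : ((a₀ : ℝ) - w₀) * (b₁ - w₁) - (a₁ - w₁) * (b₀ - w₀) ≠ 0 := by exact_mod_cast hdet
  have hsum : x * (u * (a₀ - w₀) + v * (a₁ - w₁)) + y * (u * (b₀ - w₀) + v * (b₁ - w₁)) +
      z * (u * (c₀ - w₀) + v * (c₁ - w₁)) = 0 := by
    linear_combination (-u) * h₀' - v * h₁'
  have fa := mul_nonneg hx'.le ea
  have fb := mul_nonneg hy'.le eb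
  have fc := mul_nonneg hz'.le ec
  have ga : u * (a₀ - w₀) + v * (a₁ - w₁) = 0 := by
    rcases mul_eq_zero.1 (le_antisymm (by linarith) fa) with h | h
    · exact absurd h hx'.ne'
    · exact h
  have gb : u * (b₀ - w₀) + v * (b₁ - w₁) = 0 := by
    rcases mul_eq_zero.1 (le_antisymm (by linarith) fb) with h | h
    · exact absurd h hy'.ne'
    · exact h
  have hu : u = 0 := by
    refine (mul_eq_zero.1 ?_).resolve_left hdet'
    linear_combination (b₁ - w₁ : ℝ) * ga - (a₁ - w₁) * gb
  have hv : v = 0 := by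
    refine (mul_eq_zero.1 ?_).resolve_left hdet'
    linear_combination (a₀ - w₀ : ℝ) * gb - (b₀ - w₀) * ga
  simp [hu, hv] at hne

theorem LatticeFreeConvex.inStrip_or_of_upper (hT : LatticeFreeConvex T) (h₁ : T (-1) 0)
    (h₂ : T 1 0) (hup : ∀ i j : ℤ, T i j → 0 ≤ j) : InStrip T ∨ HasDoubleTriangle T := by
  by_cases hone : ∀ i j : ℤ, T i j → j ≤ 1
  · refine Or.inl ⟨0, 1, -1, 0, 0, by norm_num, fun i j hij => ?_⟩
    have := hup i j hij
    have := hone i j hij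
    omega
  push Not at hone
  obtain ⟨a, b, hab, hb⟩ := hone
  have hkey : ∀ w : ℤ, b * w - a < b - 1 → -(b - 1) < b * w - a → False := fun w hw hw' =>
    hT.not_interior w 1 h₁ h₂ hab (b - 1 - (b * w - a)) (b - 1 + (b * w - a)) 2 (by linarith)
      (by linarith) (by norm_num) (by ring) (by ring) (by ring_nf; norm_num)
  have hdiv := Int.mul_ediv_add_emod a b
  have hmod := Int.emod_nonneg a (show b ≠ 0 by omega)
  have hmod' := Int.emod_lt_of_pos a (show 0 < b by omega)
  rcases (show a % b < b - 1 ∨ a % b = b - 1 by omega) with h | h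
  · exact (hkey (a / b) (by linarith) (by linarith)).elim
  · rcases (show b = 2 ∨ 3 ≤ b by omega) with rfl | hb3
    · refine Or.inr ⟨-1, 0, 1, 0, a / 2 + 1, 1, by norm_num, h₁, h₂, ?_⟩
      convert hab using 1
      · omega
      · norm_num
    · exact (hkey (a / b + 1) (by linarith) (by linarith)).elim

theorem LatticeFreeConvex.inStrip_or_of_midpoint (hT : LatticeFreeConvex T) {i j a b : ℤ}
    (hab : a ≠ 0 ∨ b ≠ 0) (h₁ : T (i - a) (j - b)) (h₂ : T (i + a) (j + b)) :
    InStrip T ∨ HasDoubleTriangle T := by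
  obtain ⟨g, e₀, e₁, d₀, d₁, hg, rfl, rfl, hdet⟩ := exists_primitive_basis hab
  have h₁' : T (i - e₀) (j - e₁) := hT.convex h₁ h₂ h₂ (g + 1) (g - 1) 0 (by omega) (by omega)
    le_rfl (by omega) (by ring) (by ring)
  have h₂' : T (i + e₀) (j + e₁) := hT.convex h₁ h₂ h₂ (g - 1) (g + 1) 0 (by omega) (by omega)
    le_rfl (by omega) (by ring) (by ring)
  have h₀ : T i j := hT.convex h₁ h₂ h₂ 1 1 0 (by omega) (by omega) le_rfl (by omega) (by ring)
    (by ring)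
  obtain ⟨u, v, hne, h⟩ := hT.support h₀
  have hdet' : (e₀ : ℝ) * d₁ - e₁ * d₀ = 1 := by exact_mod_cast hdet
  have hflat : u * e₀ + v * e₁ = 0 := by
    have e1 := h _ _ h₁'
    have e2 := h _ _ h₂'
    push_cast at e1 e2
    linarith
  have hform : ∀ i' j' : ℤ, u * ((i + i' * e₀ + j' * d₀ : ℤ) - i) +
      v * ((j + i' * e₁ + j' * d₁ : ℤ) - j) = j' * (u * d₀ + v * d₁) := by
    intro i' j'
    push_cast
    linear_combination i' * hflat
  rcases lt_trichotomy (u * d₀ + v * d₁) 0 with hneg | hzero | hpos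
  · refine inStrip_or_of_pullback (o₀ := i) (o₁ := j) (e₀ := -e₀) (e₁ := -e₁) (d₀ := -d₀)
      (d₁ := -d₁) (by linear_combination hdet) ?_
    refine (hT.pullback i j (by linear_combination hdet)).inStrip_or_of_upper ?_ ?_
      fun i' j' hij' => ?_
    · unfold latticePullback
      convert h₂' using 1 <;> ring
    · unfold latticePullback
      convert h₁' using 1 <;> ring
    · have e1 := h _ _ hij'
      have e2 := hform (-i') (-j')
      have e3 : (j' : ℝ) * (u * d₀ + v * d₁) ≤ 0 := by
        push_cast at e1 e2
        linarith
      have e4 : (0 : ℝ) ≤ j' := by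
        by_contra! hlt
        linarith [mul_pos_of_neg_of_neg hlt hneg]
      exact_mod_cast e4
  · have hu : u = 0 := by linear_combination d₁ * hflat - e₁ * hzero - u * hdet'
    have hv : v = 0 := by linear_combination e₀ * hzero - d₀ * hflat - v * hdet'
    simp [hu, hv] at hne
  · refine inStrip_or_of_pullback (o₀ := i) (o₁ := j) hdet ?_
    refine (hT.pullback i j hdet).inStrip_or_of_upper ?_ ?_ fun i' j' hij' => ?_
    · unfold latticePullback
      convert h₁' using 1 <;> ring
    · unfold latticePullback
      convert h₂' using 1 <;> ring
    · have e1 := h _ _ hij'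
      rw [hform] at e1
      exact_mod_cast nonneg_of_mul_nonneg_left e1 hpos

theorem LatticeFreeConvex.inStrip_of_unit_triangle (hT : LatticeFreeConvex T)
    (hN : ∀ i j a b : ℤ, T (i - a) (j - b) → T (i + a) (j + b) → a = 0 ∧ b = 0)
    (h₀ : T 0 0) (h₁ : T 1 0) (h₂ : T 0 1) : InStrip T := by
  have hpar : ∀ i j a b : ℤ, T i j → T (i + 2 * a) (j + 2 * b) → a = 0 ∧ b = 0 := by
    intro i j a b h h'
    refine hN (i + a) (j + b) a b (by simpa using h) ?_
    convert h' using 1 <;> ring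
  have hodd : ∀ p q : ℤ, T p q → (p = 0 ∧ q = 0) ∨ (p = 1 ∧ q = 0) ∨ (p = 0 ∧ q = 1) ∨
      (p % 2 = 1 ∧ q % 2 = 1) := by
    intro p q h
    rcases Int.emod_two_eq_zero_or_one p with hp | hp <;>
    rcases Int.emod_two_eq_zero_or_one q with hq | hq
    · have := hpar 0 0 (p / 2) (q / 2) h₀ (by convert h using 1 <;> omega)
      omega
    · have := hpar 0 1 (p / 2) (q / 2) h₂ (by convert h using 1 <;> omega)
      omega
    · have := hpar 1 0 (p / 2) (q / 2) h₁ (by convert h using 1 <;> omega)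
      omega
    · exact Or.inr (Or.inr (Or.inr ⟨hp, hq⟩))
  have huniq : ∀ {p q p' q' : ℤ}, T p q → T p' q' → p % 2 = 1 → q % 2 = 1 → p' % 2 = 1 →
      q' % 2 = 1 → p' = p ∧ q' = q := by
    intro p q p' q' h h' hp hq hp' hq'
    have := hpar p q ((p' - p) / 2) ((q' - q) / 2) h (by convert h' using 1 <;> omega)
    omega
  have hmir : ∀ p q : ℤ, T p q → p % 2 = 1 → q % 2 = 1 →
      (p = 1 ∧ q = 1) ∨ (p = -1 ∧ q = 1) ∨ (p = 1 ∧ q = -1) := by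
    intro p q h hp hq
    rcases lt_or_gt_of_ne (show p ≠ 0 by omega) with hp0 | hp0 <;>
    rcases lt_or_gt_of_ne (show q ≠ 0 by omega) with hq0 | hq0
    · exact (hT.not_interior 0 0 h₁ h₂ h (-p) (-q) 1 (by omega) (by omega) one_pos (by ring)
        (by ring) (by norm_num)).elim
    · by_cases hpq : 1 < p + q
      · exact (hT.not_interior 0 1 h₀ h₁ h (p + q - 1) (-p) 1 (by omega) (by omega) one_pos
          (by ring) (by ring) (by norm_num)).elim
      · have := hT.convex (w₀ := -1) (w₁ := 1) h₀ h₂ h (q - 1) (-p - q) 1 (by omega) (by omega)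
          zero_le_one (by omega) (by ring) (by ring)
        have := huniq h this hp hq (by norm_num) (by norm_num)
        omega
    · by_cases hpq : 1 < p + q
      · exact (hT.not_interior 1 0 h₀ h₂ h (p + q - 1) (-q) 1 (by omega) (by omega) one_pos
          (by ring) (by ring) (by norm_num)).elim
      · have := hT.convex (w₀ := 1) (w₁ := -1) h₀ h₁ h (p - 1) (-p - q) 1 (by omega) (by omega)
          zero_le_one (by omega) (by ring) (by ring)
        have := huniq h this hp hq (by norm_num) (by norm_num)
        omega
    · have := hT.convex (w₀ := 1) (w₁ := 1) h₁ h₂ h (q - 1) (p - 1) 1 (by omega) (by omega)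
          zero_le_one (by omega) (by ring) (by ring)
      have := huniq h this hp hq (by norm_num) (by norm_num)
      omega
  by_cases hm : T 1 (-1)
  · refine ⟨1, 0, 0, 1, 0, by norm_num, fun i j hij => ?_⟩
    rcases hodd i j hij with h | h | h | h
    · omega
    · omega
    · omega
    · have := huniq hm hij (by norm_num) (by norm_num) h.1 h.2
      omega
  · refine ⟨0, 1, -1, 0, 0, by norm_num, fun i j hij => ?_⟩
    rcases hodd i j hij with h | h | h | h
    · omega
    · omega
    · omega
    · rcases hmir i j hij h.1 h.2 with h' | h' | ⟨rfl, rfl⟩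
      · omega
      · omega
      · exact absurd hij hm

theorem LatticeFreeConvex.inStrip_of_unit_segment (hT : LatticeFreeConvex T)
    (hN : ∀ i j a b : ℤ, T (i - a) (j - b) → T (i + a) (j + b) → a = 0 ∧ b = 0)
    (h₀ : T 0 0) (h₁ : T 1 0) {p q : ℤ} (h : T p q) (hq : 0 < q) : InStrip T := by
  have hmod := Int.emod_nonneg (-p) hq.ne'
  have hmod' := Int.emod_lt_of_pos (-p) hq
  have hdiv := Int.mul_ediv_add_emod (-p) q
  have hu : T (-(-p / q)) 1 := hT.convex h₀ h₁ h (q - 1 - -p % q) (-p % q) 1 (by omega) hmod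
    zero_le_one (by omega) (by linear_combination -hdiv) (by ring)
  have hdet : (1 : ℤ) * 1 - 0 * -(-p / q) = 1 := by norm_num
  refine InStrip.of_pullback (o₀ := 0) (o₁ := 0) hdet
    ((hT.pullback 0 0 hdet).inStrip_of_unit_triangle (fun i j a b h h' => ?_) ?_ ?_ ?_)
  · unfold latticePullback at h h'
    have := hN (i + j * -(-p / q)) j (a + b * -(-p / q)) b (by convert h using 1 <;> ring)
      (by convert h' using 1 <;> ring)
    obtain ⟨e1, rfl⟩ := this
    omega
  · simpa [latticePullback] using h₀
  · simpa [latticePullback] using h₁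
  · simpa [latticePullback] using hu

theorem LatticeFreeConvex.inStrip_or (hT : LatticeFreeConvex T) :
    InStrip T ∨ HasDoubleTriangle T := by
  by_cases hN : ∀ i j a b : ℤ, T (i - a) (j - b) → T (i + a) (j + b) → a = 0 ∧ b = 0
  swap
  · push Not at hN
    obtain ⟨i, j, a, b, h₁, h₂, hab⟩ := hN
    exact hT.inStrip_or_of_midpoint (by by_cases a = 0 <;> tauto) h₁ h₂
  left
  by_cases hsub : ∀ i j i' j' : ℤ, T i j → T i' j' → j = j'
  · by_cases hempty : ∃ i j, T i j
    · obtain ⟨i, j, hij⟩ := hempty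
      refine ⟨0, 1, -1, 0, j, by norm_num, fun i' j' h => ?_⟩
      have := hsub _ _ _ _ hij h
      omega
    · push Not at hempty
      exact ⟨0, 1, -1, 0, 0, by norm_num, fun i j hij => absurd hij (hempty i j)⟩
  push Not at hsub
  obtain ⟨i, j, i', j', hij, hij', hne⟩ := hsub
  obtain ⟨g, e₀, e₁, d₀, d₁, hg, h0, h1, hdet⟩ :=
    exists_primitive_basis (a := i' - i) (b := j' - j) (Or.inr (by omega))
  have he : T (i + e₀) (j + e₁) := hT.convex hij hij' hij' (g - 1) 1 0 (by omega) zero_le_one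
    le_rfl (by omega) (by linear_combination -h0) (by linear_combination -h1)
  have hN' : ∀ o₀ o₁ e₀ e₁ d₀ d₁ : ℤ, e₀ * d₁ - e₁ * d₀ = 1 → ∀ i j a b : ℤ,
      latticePullback T o₀ o₁ e₀ e₁ d₀ d₁ (i - a) (j - b) →
      latticePullback T o₀ o₁ e₀ e₁ d₀ d₁ (i + a) (j + b) → a = 0 ∧ b = 0 := by
    intro o₀ o₁ e₀ e₁ d₀ d₁ hdet i j a b h h'
    unfold latticePullback at h h'
    obtain ⟨h1, h2⟩ := hN (o₀ + i * e₀ + j * d₀) (o₁ + i * e₁ + j * d₁) (a * e₀ + b * d₀)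
      (a * e₁ + b * d₁) (by convert h using 1 <;> ring) (by convert h' using 1 <;> ring)
    constructor
    · linear_combination d₁ * h1 - d₀ * h2 - a * hdet
    · linear_combination e₀ * h2 - e₁ * h1 - b * hdet
  by_cases hline : ∀ x y : ℤ, T x y → e₀ * (y - j) - e₁ * (x - i) = 0
  · refine ⟨-e₁, e₀, -d₁, d₀, e₀ * j - e₁ * i, by linear_combination hdet, fun x y hxy => ?_⟩
    have := hline x y hxy
    constructor <;> linarith
  push Not at hline
  obtain ⟨x, y, hxy, hxy0⟩ := hline
  rcases lt_or_gt_of_ne hxy0 with hlt | hgt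
  · have hdet' : (-e₀) * (-d₁) - (-e₁) * (-d₀) = 1 := by linear_combination hdet
    refine InStrip.of_pullback (o₀ := i + e₀) (o₁ := j + e₁) hdet'
      ((hT.pullback _ _ hdet').inStrip_of_unit_segment (hN' _ _ _ _ _ _ hdet') ?_ ?_
        (latticePullback_of_solve hdet' hxy) (by linarith))
    · simpa [latticePullback] using he
    · simpa [latticePullback] using hij
  · refine InStrip.of_pullback (o₀ := i) (o₁ := j) hdet
      ((hT.pullback _ _ hdet).inStrip_of_unit_segment (hN' _ _ _ _ _ _ hdet) ?_ ?_
        (latticePullback_of_solve hdet hxy) hgt)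
    · simpa [latticePullback] using hij
    · simpa [latticePullback] using he

end Combinatorics

section Triangle

variable {k : ℕ} {r : Fin k → Pt} {f : Pt} {α : Fin k → ℝ}

theorem inducedSet_eq_convexHull (hα : ∀ i, 0 < α i) : inducedSet k r f α =
    convexHull ℝ ({f} ∪ {x | ∃ i, 0 < α i ∧ x = f + (α i)⁻¹ • r i}) := by
  have hcone : coneGen {x | ∃ i, α i = 0 ∧ x = r i} = {0} := by
    refine Set.Subset.antisymm ?_ (Set.singleton_subset_iff.2 (zero_mem_coneGen _))
    rintro x ⟨n, c, v, -, hv, rfl⟩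
    refine Finset.sum_eq_zero fun j _ => ?_
    obtain ⟨i, hi, -⟩ := hv j
    exact absurd hi (hα i).ne'
  rw [inducedSet, hcone, Set.singleton_zero, add_zero]

theorem Tight.mem_inducedSet (hα : ∀ i, 0 < α i) {i j : ℤ} (h : Tight k r f α i j) :
    (![(i : ℝ), j] : Pt) ∈ inducedSet k r f α := by
  obtain ⟨s, ⟨hs, hse⟩, hs1⟩ := h
  rw [inducedSet_eq_convexHull hα]
  have hmem := (convex_convexHull ℝ ({f} ∪ {x | ∃ i, 0 < α i ∧ x = f + (α i)⁻¹ • r i})).sum_mem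
    (t := Finset.univ)
    (w := fun o : Option (Fin k) => o.elim (1 - ∑ l, α l * s l) fun l => α l * s l)
    (z := fun o => o.elim f fun l => f + (α l)⁻¹ • r l)
    (by
      rintro (_ | l) -
      · exact sub_nonneg.2 hs1
      · exact mul_nonneg (hα l).le (hs l))
    (by simp [Fintype.sum_option])
    (by
      rintro (_ | l) -
      · exact subset_convexHull ℝ _ (Or.inl rfl)
      · exact subset_convexHull ℝ _ (Or.inr ⟨l, hα l, rfl⟩))
  convert hmem using 1
  rw [Fintype.sum_option]
  simp only [Option.elim, smul_add, smul_smul, Finset.sum_add_distrib, ← Finset.sum_smul]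
  rw [← add_assoc, ← add_smul, sub_add_cancel, one_smul]
  refine hse.trans (congrArg _ (Finset.sum_congr rfl fun l _ => ?_))
  have := (hα l).ne'
  congr 1
  dsimp only
  field_simp

theorem convex_setOf_form_nonneg (a b c d : ℝ) :
    Convex ℝ {x : Pt | 0 ≤ a * (x 0 - c) + b * (x 1 - d)} := by
  intro x hx y hy s t hs ht hst
  have h := add_nonneg (mul_nonneg hs hx) (mul_nonneg ht hy)
  simp only [mem_ofPred_eq, Pi.add_apply, Pi.smul_apply, smul_eq_mul]
  have e : a * (s * x 0 + t * y 0 - c) + b * (s * x 1 + t * y 1 - d) =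
      s * (a * (x 0 - c) + b * (x 1 - d)) + t * (a * (y 0 - c) + b * (y 1 - d)) := by
    linear_combination (a * c + b * d) * hst
  rw [e]
  exact h

theorem form_nonneg_of_mem_inducedSet (hα : ∀ i, 0 < α i) {a b c d : ℝ}
    (h : 1 ≤ a * (f 0 - c) + b * (f 1 - d)) (h' : ∀ l, 0 ≤ α l + a * r l 0 + b * r l 1) {x : Pt}
    (hx : x ∈ inducedSet k r f α) : 0 ≤ a * (x 0 - c) + b * (x 1 - d) := by
  rw [inducedSet_eq_convexHull hα] at hx
  refine convexHull_min ?_ (convex_setOf_form_nonneg a b c d) hx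
  rintro y (rfl | ⟨l, hl, rfl⟩)
  · simp only [mem_ofPred_eq]
    linarith
  · simp only [mem_ofPred_eq, Pi.add_apply, Pi.smul_apply, smul_eq_mul]
    have h1 := mul_nonneg (inv_nonneg.2 hl.le) (h' l)
    have h2 : (α l)⁻¹ * α l = 1 := inv_mul_cancel₀ hl.ne'
    have h3 : (α l)⁻¹ * (α l + a * r l 0 + b * r l 1) =
      1 + a * ((α l)⁻¹ * r l 0) + b * ((α l)⁻¹ * r l 1) := by
      linear_combination h2
    rw [h3] at h1
    linarith

/-- The induced set lies on one side of a line that contains two tight points whose midpoint is a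
lattice point, namely on the side of any other tight point. -/
theorem det_nonneg_of_tight (hα : ∀ i, 0 < α i) (hvalid : ValidIneq k r f α 1)
    {x₀ x₁ e₀ e₁ w₀ w₁ : ℤ} (h₁ : Tight k r f α x₀ x₁)
    (h₂ : Tight k r f α (x₀ + 2 * e₀) (x₁ + 2 * e₁)) (h₃ : Tight k r f α (x₀ + w₀) (x₁ + w₁))
    (hdet : 0 < e₀ * w₁ - e₁ * w₀) {x : Pt} (hx : x ∈ inducedSet k r f α) :
    0 ≤ e₀ * (x 1 - x₁) - e₁ * (x 0 - x₀) := by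
  obtain ⟨a, b, hf, hr, -, hT⟩ :=
    Tight.exists_support (fun i => (hα i).le) hvalid (x₀ + e₀) (x₁ + e₁)
  have hG := form_nonneg_of_mem_inducedSet hα hf hr hx
  have t₁ := hT _ _ h₁
  have t₂ := hT _ _ h₂
  have t₃ := hT _ _ h₃
  push_cast at hf hG t₁ t₂ t₃
  have hflat : a * e₀ + b * e₁ = 0 := by linarith
  have hdet' : (0 : ℝ) < e₀ * w₁ - e₁ * w₀ := by exact_mod_cast hdet
  have hprop : ∀ y₀ y₁ : ℝ, (a * y₀ + b * y₁) * (e₀ * w₁ - e₁ * w₀) =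
      (a * w₀ + b * w₁) * (e₀ * y₁ - e₁ * y₀) := by
    intro y₀ y₁
    linear_combination (y₀ * w₁ - y₁ * w₀) * hflat
  have hpos : 0 < a * w₀ + b * w₁ := by
    refine lt_of_le_of_ne (by linarith) fun h0 => ?_
    have h := hprop (f 0 - (x₀ + e₀)) (f 1 - (x₁ + e₁))
    rw [← h0, zero_mul] at h
    have := mul_pos (lt_of_lt_of_le one_pos hf) hdet'
    linarith
  have h := hprop (x 0 - x₀) (x 1 - x₁)
  have hG' : 0 ≤ a * (x 0 - x₀) + b * (x 1 - x₁) := by linarith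
  refine nonneg_of_mul_nonneg_right ?_ hpos
  rw [← h]
  exact mul_nonneg hG' hdet'.le

theorem existsUnique_isIntPt_openSegment {x₀ x₁ e₀ e₁ w₀ w₁ : ℤ} (hdet : e₀ * w₁ - e₁ * w₀ = 1)
    {X Y : Pt} (hX : X = ![(x₀ : ℝ), x₁]) (hY : Y = ![(x₀ : ℝ) + 2 * e₀, x₁ + 2 * e₁]) :
    ∃! z, z ∈ openSegment ℝ X Y ∧ IsIntPt z := by
  have hdet' : (e₀ : ℝ) * w₁ - e₁ * w₀ = 1 := by exact_mod_cast hdet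
  subst hX hY
  refine ⟨![((x₀ + e₀ : ℤ) : ℝ), (x₁ + e₁ : ℤ)],
    ⟨⟨1 / 2, 1 / 2, by norm_num, by norm_num, by norm_num, ?_⟩, isIntPt_vec _ _⟩, ?_⟩
  · ext l
    fin_cases l <;> simp <;> ring
  · rintro z ⟨⟨s, t, hs, ht, hst, rfl⟩, hz⟩
    obtain ⟨m, hm⟩ := hz 0
    obtain ⟨n, hn⟩ := hz 1
    simp at hm hn
    have hval : 2 * t = (((m - x₀) * w₁ - (n - x₁) * w₀ : ℤ) : ℝ) := by
      push_cast
      rw [← hm, ← hn]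
      linear_combination -2 * t * hdet' - (x₀ * w₁ - x₁ * w₀) * hst
    have h0 : (0 : ℝ) < (((m - x₀) * w₁ - (n - x₁) * w₀ : ℤ) : ℝ) := by linarith
    have h2 : (((m - x₀) * w₁ - (n - x₁) * w₀ : ℤ) : ℝ) < 2 := by linarith
    have h0' : 0 < (m - x₀) * w₁ - (n - x₁) * w₀ := by exact_mod_cast h0
    have h2' : (m - x₀) * w₁ - (n - x₁) * w₀ < 2 := by exact_mod_cast h2
    rw [show (m - x₀) * w₁ - (n - x₁) * w₀ = 1 by omega] at hval
    push_cast at hval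
    ext l
    fin_cases l
    · simp
      linear_combination x₀ * hst + e₀ * hval
    · simp
      linear_combination x₁ * hst + e₁ * hval

theorem isT1_inducedSet (hα : ∀ i, 0 < α i) (hvalid : ValidIneq k r f α 1)
    (h : HasDoubleTriangle (Tight k r f α)) : IsT1 (inducedSet k r f α) := by
  obtain ⟨a₀, a₁, u₀, u₁, v₀, v₁, hdet, ha, hu, hv⟩ := h
  have hdet' : (u₀ : ℝ) * v₁ - u₁ * v₀ = 1 := by exact_mod_cast hdet
  set V : Fin 3 → Pt := ![![(a₀ : ℝ), a₁], ![((a₀ + 2 * u₀ : ℤ) : ℝ), (a₁ + 2 * u₁ : ℤ)],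
    ![((a₀ + 2 * v₀ : ℤ) : ℝ), (a₁ + 2 * v₁ : ℤ)]] with hV
  have h01 := existsUnique_isIntPt_openSegment (X := V 0) (Y := V 1) hdet rfl (by simp [hV])
  have h02 := existsUnique_isIntPt_openSegment (X := V 0) (Y := V 2) (e₀ := v₀) (e₁ := v₁)
    (w₀ := -u₀) (w₁ := -u₁) (by linear_combination hdet) rfl (by simp [hV])
  have h12 := existsUnique_isIntPt_openSegment (X := V 1) (Y := V 2) (e₀ := v₀ - u₀)
    (e₁ := v₁ - u₁) (w₀ := -u₀) (w₁ := -u₁) (by linear_combination hdet) rfl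
    (by
      ext l
      fin_cases l <;> simp [hV] <;> ring)
  refine ⟨V, ?_, fun i => ?_, Set.Subset.antisymm (fun x hx => ?_) ?_, fun i j hij => ?_⟩
  · rw [affineIndependent_iff_of_fintype]
    intro w hw hsum
    rw [Finset.weightedVSub_eq_linear_combination _ hw, Fin.sum_univ_three] at hsum
    rw [Fin.sum_univ_three] at hw
    have e0 := congrFun hsum 0
    have e1 := congrFun hsum 1
    simp [hV] at e0 e1
    have h1 : w 1 = 0 := by
      linear_combination (v₁ / 2 : ℝ) * e0 - v₀ / 2 * e1 - w 1 * hdet' -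
        (a₀ * v₁ - a₁ * v₀) / 2 * hw
    have h2 : w 2 = 0 := by
      linear_combination (u₀ / 2 : ℝ) * e1 - u₁ / 2 * e0 - w 2 * hdet' -
        (a₁ * u₀ - a₀ * u₁) / 2 * hw
    have h0 : w 0 = 0 := by linarith
    intro i
    fin_cases i
    · exact h0
    · exact h1
    · exact h2
  · fin_cases i <;> exact isIntPt_vec _ _
  · have s1 := det_nonneg_of_tight hα hvalid ha hu hv (by linarith) hx
    have s2 := det_nonneg_of_tight hα hvalid (e₀ := -v₀) (e₁ := -v₁) (w₀ := 2 * u₀ - 2 * v₀)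
      (w₁ := 2 * u₁ - 2 * v₁) hv (by convert ha using 1 <;> ring) (by convert hu using 1 <;> ring)
      (by linarith) hx
    have s3 := det_nonneg_of_tight hα hvalid (e₀ := v₀ - u₀) (e₁ := v₁ - u₁)
      (w₀ := -2 * u₀) (w₁ := -2 * u₁) hu (by convert hv using 1 <;> ring)
      (by convert ha using 1 <;> ring) (by linarith) hx
    push_cast at s1 s2 s3
    have hmem := (convex_convexHull ℝ (Set.range V)).sum_mem (t := Finset.univ)
      (w := ![((v₀ - u₀) * (x 1 - (a₁ + 2 * u₁)) - (v₁ - u₁) * (x 0 - (a₀ + 2 * u₀))) / 2,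
        (-v₀ * (x 1 - (a₁ + 2 * v₁)) - -v₁ * (x 0 - (a₀ + 2 * v₀))) / 2,
        (u₀ * (x 1 - a₁) - u₁ * (x 0 - a₀)) / 2]) (z := V)
      (by
        intro i _
        fin_cases i
        · exact div_nonneg s3 zero_le_two
        · exact div_nonneg s2 zero_le_two
        · exact div_nonneg s1 zero_le_two)
      (by
        simp [Fin.sum_univ_three]
        linear_combination hdet')
      (fun i _ => subset_convexHull ℝ _ ⟨i, rfl⟩)
    convert hmem using 1
    ext l
    fin_cases l
    · simp [Fin.sum_univ_three, hV]
      linear_combination (-x 0) * hdet'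
    · simp [Fin.sum_univ_three, hV]
      linear_combination (-x 1) * hdet'
  · refine convexHull_min ?_ ?_
    · rintro x ⟨i, rfl⟩
      fin_cases i
      · exact ha.mem_inducedSet hα
      · exact hu.mem_inducedSet hα
      · exact hv.mem_inducedSet hα
    · rw [inducedSet_eq_convexHull hα]
      exact convex_convexHull ℝ _
  · fin_cases i <;> fin_cases j
    · exact absurd rfl hij
    · exact h01
    · exact h02
    · rw [openSegment_symm]
      exact h01
    · exact absurd rfl hij
    · exact h12
    · rw [openSegment_symm]
      exact h02
    · rw [openSegment_symm]
      exact h12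
    · exact absurd rfl hij

theorem latticeFreeConvex_tight (hα : ∀ i, 0 < α i) (hvalid : ValidIneq k r f α 1) :
    LatticeFreeConvex (Tight k r f α) where
  convex ha hb hc _ _ _ hx hy hz hn h₀ h₁ := ha.of_barycentric hb hc hx hy hz hn h₀ h₁
  support {i j} _ := by
    obtain ⟨a, b, hf, -, -, hT⟩ := Tight.exists_support (fun i => (hα i).le) hvalid i j
    refine ⟨a, b, ?_, fun i' j' h => by linarith [hT i' j' h]⟩
    by_contra! h0
    rw [h0.1, h0.2] at hf
    linarith

end Triangle

theorem main_split_rank_finite_iff_not_T1 (k : ℕ)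
    (hk : 1 ≤ k)
    (r : Fin k → Pt) (f : Pt)
    (hr_rat : ∀ i, IsRatPt (r i)) (hr_ne : ∀ i, r i ≠ 0)
    (hf_rat : IsRatPt f) (hf_int : ¬ IsIntPt f)
    (hne : (mixedP k r f).Nonempty)
    (α : Fin k → ℝ) (hα : ∀ i, 0 ≤ α i)
    (hfacet : IsFacet k r f α 1) :
    splitRank k r f α 1 ≠ ⊤ ↔ ¬ IsT1 (inducedSet k r f α) := by
  rw [splitRank_one_ne_top_iff]
  refine ⟨fun h hT => not_finiteRank_of_isT1 hf_int hT h, fun hT => ?_⟩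
  by_cases hzero : ∃ i, α i = 0
  · obtain ⟨i, hi⟩ := hzero
    exact FiniteRank.of_zero_coefficient hfacet.1 hi (hr_rat i) (hr_ne i)
  push Not at hzero
  have hpos : ∀ i, 0 < α i := fun i => (hα i).lt_of_ne' (hzero i)
  rcases (latticeFreeConvex_tight hpos hfacet.1).inStrip_or with h | h
  · obtain ⟨p, q, p', q', m, hdet, hstrip⟩ := h
    exact finiteRank_of_tight_subset_strip hpos hfacet.1 hdet hstrip
  · exact absurd (isT1_inducedSet hpos hfacet.1 h) hT
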